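/- arXiv:2503.24221 — 2 statements merged into one kernel-verified Lean document; each statement's English description precedes it below -/
import Mathlib

section
/- For F a finite extension of Q_p and D the central division algebra over F of invariant 1/n, the reduced norm Nrd : D^× → F^× restricts to a surjection from the set of regular elliptic elements of D^× onto F^×. -/
open TensorProduct

theorem aux_simple {F D E : Type*} [Field F] [DivisionRing D] [Algebra F D] [Field E] [Algebra F E]
    (hc : Subalgebra.center F D = ⊥) : IsSimpleRing (D ⊗[F] E) := by
  classical
  rw [isSimpleRing_iff_isTwoSided_imp]
  refine ⟨inferInstance, fun I hI => ?_⟩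
  by_contra hcon
  push Not at hcon
  obtain ⟨h0, h1⟩ := hcon
  let b := Module.Basis.ofVectorSpace F E
  let B := Algebra.TensorProduct.basis D b
  have hex : ∃ m : ℕ, ∃ x ∈ I, x ≠ 0 ∧ (B.repr x).support.card = m := by
    obtain ⟨x, hx, hx0⟩ := (Submodule.ne_bot_iff I).1 h0
    exact ⟨_, x, hx, hx0, rfl⟩
  obtain ⟨x, hx, hx0, hxm⟩ := Nat.find_spec hex
  have hmin : ∀ y ∈ I, (B.repr y).support.card < (B.repr x).support.card → y = 0 := by
    intro y hy hlt
    by_contra hy0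
    rw [hxm] at hlt
    exact Nat.find_min hex hlt ⟨y, hy, hy0, rfl⟩
  have hne : (B.repr x).support.Nonempty := by
    rw [Finsupp.support_nonempty_iff]
    simpa using hx0
  obtain ⟨i0, hi0⟩ := hne
  have hi0' := Finsupp.mem_support_iff.1 hi0
  have hl : ∀ (d : D) (y : D ⊗[F] E) (i), B.repr ((d ⊗ₜ 1) * y) i = d * B.repr y i := by
    intro d y i
    have : (d ⊗ₜ[F] (1 : E)) * y = d • y := by
      induction y using TensorProduct.induction_on with
      | zero => simp
      | tmul a c => simp [TensorProduct.smul_tmul']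
      | add a c ha hc => rw [mul_add, ha, hc, smul_add]
    rw [this]; simp
  have hr : ∀ (d : D) (y : D ⊗[F] E) (i), B.repr (y * (d ⊗ₜ 1)) i = B.repr y i * d := by
    intro d y i
    induction y using TensorProduct.induction_on with
    | zero => simp
    | tmul a c =>
      simp only [Algebra.TensorProduct.tmul_mul_tmul, mul_one, B]
      simp [mul_assoc, Algebra.commutes]
    | add a c ha hc => rw [add_mul, map_add, map_add, Finsupp.add_apply, Finsupp.add_apply, ha, hc, add_mul]
  set d0 := (B.repr x i0)⁻¹ with hd0
  set y := (d0 ⊗ₜ[F] (1 : E)) * x with hy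
  have hyI : y ∈ I := I.mul_mem_left _ hx
  have hyi : ∀ i, B.repr y i = d0 * B.repr x i := fun i => hl _ _ _
  have hy1 : B.repr y i0 = 1 := by rw [hyi, hd0, inv_mul_cancel₀ hi0']
  have hcomm : ∀ d : D, (d ⊗ₜ[F] (1 : E)) * y - y * (d ⊗ₜ[F] (1 : E)) = 0 := by
    intro d
    apply hmin
    · exact I.sub_mem (I.mul_mem_left _ hyI) (I.mul_mem_right _ hyI)
    · apply Finset.card_lt_card
      rw [Finset.ssubset_iff_of_subset]
      · refine ⟨i0, hi0, ?_⟩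
        simp [hl, hr, hy1]
      · intro i hi
        rw [Finsupp.mem_support_iff] at hi ⊢
        intro h
        apply hi
        simp [hl, hr, hyi, h]
  have hcen : ∀ i, ∃ a : F, algebraMap F D a = B.repr y i := by
    intro i
    have : B.repr y i ∈ Subalgebra.center F D := by
      rw [Subalgebra.mem_center_iff]
      intro d
      have := congrArg (fun z => B.repr z i) (hcomm d)
      simp only [map_sub, Finsupp.sub_apply, hl, hr, map_zero, Finsupp.zero_apply] at this
      exact sub_eq_zero.1 this
    rw [hc] at this
    exact Algebra.mem_bot.1 this
  choose a ha using hcen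
  have hy2 : y = (1 : D) ⊗ₜ[F] (∑ i ∈ (B.repr y).support, a i • b i) := by
    conv_lhs => rw [← B.linearCombination_repr y]
    rw [Finsupp.linearCombination_apply, Finsupp.sum, TensorProduct.tmul_sum]
    refine Finset.sum_congr rfl fun i _ => ?_
    rw [← ha, TensorProduct.tmul_smul]
    simp [B]
  set e := ∑ i ∈ (B.repr y).support, a i • b i
  have he : e ≠ 0 := by
    intro h
    rw [h, TensorProduct.tmul_zero] at hy2
    rw [hy2] at hy1
    simp at hy1
  apply h1
  rw [Ideal.eq_top_iff_one]
  have := I.mul_mem_left ((1 : D) ⊗ₜ[F] e⁻¹) hyI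
  rw [hy2] at this
  rw [Algebra.TensorProduct.one_def]
  simpa [inv_mul_cancel₀ he] using this

theorem aux_split {F D : Type*} (E : Type*) [Field F] [DivisionRing D] [Algebra F D] [Field E] [Algebra F E]
    [IsAlgClosed E] (n : ℕ) (hn : 1 ≤ n) (hdim : Module.finrank F D = n * n)
    (hc : Subalgebra.center F D = ⊥) :
    ∃ φ : D →ₐ[F] Matrix (Fin n) (Fin n) E,
      ∀ (m : ℕ) (v : Fin m → D), LinearIndependent F v → LinearIndependent E (φ ∘ v) := by
  classical
  have hpos : 0 < Module.finrank F D := by rw [hdim]; positivity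
  have : FiniteDimensional F D := Module.finite_of_finrank_pos hpos
  have := aux_simple (E := E) hc
  have : IsSimpleRing (E ⊗[F] D) :=
    IsSimpleRing.of_ringEquiv (Algebra.TensorProduct.comm F D E).toRingEquiv ‹_›
  obtain ⟨m, hm, ⟨ψ⟩⟩ := IsSimpleRing.exists_algEquiv_matrix_of_isAlgClosed E (E ⊗[F] D)
  have h1 := ψ.toLinearEquiv.finrank_eq
  rw [Module.finrank_baseChange, hdim, Module.finrank_matrix] at h1
  have hmn : m = n := by
    simp at h1
    nlinarith
  subst hmn
  refine ⟨(ψ.toAlgHom.restrictScalars F).comp Algebra.TensorProduct.includeRight, ?_⟩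
  intro k v hv
  have h2 : LinearIndependent E (fun i => (1 : E) ⊗ₜ[F] v i) := by
    exact Module.Flat.linearIndependent_one_tmul hv
  exact h2.map' ψ.toLinearEquiv.toLinearMap (LinearMap.ker_eq_bot.2 ψ.injective)
open Polynomial in
theorem aux_indep {R A : Type*} [CommRing R] [Ring A] [Algebra R A] {m : ℕ} {x : A}
    (h : LinearIndependent R (fun i : Fin m => x ^ (i : ℕ))) {p : R[X]} (hp : p.degree < m)
    (h0 : aeval x p = 0) : p = 0 := by
  by_cases hp0 : p = 0
  · exact hp0
  rw [aeval_eq_sum_range' (n := m)] at h0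
  · rw [Finset.sum_range] at h0
    have := Fintype.linearIndependent_iff.1 h _ h0
    ext j
    by_cases hj : j < m
    · exact this ⟨j, hj⟩
    · rw [coeff_zero]
      exact coeff_eq_zero_of_degree_lt (lt_of_lt_of_le hp (by exact_mod_cast not_lt.1 hj))
  · exact (natDegree_lt_iff_degree_lt hp0).2 hp

open Polynomial in
theorem aux_deg_le {F D E : Type*} [Field F] [DivisionRing D] [Algebra F D] [Field E] [Algebra F E]
    {n : ℕ} (φ : D →ₐ[F] Matrix (Fin n) (Fin n) E)
    (hφ : ∀ (m : ℕ) (v : Fin m → D), LinearIndependent F v → LinearIndependent E (φ ∘ v))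
    {m : ℕ} {x : D} (hx : LinearIndependent F (fun i : Fin m => x ^ (i : ℕ))) : m ≤ n := by
  by_contra hlt
  push Not at hlt
  have h1 : LinearIndependent E (fun i : Fin m => φ x ^ (i : ℕ)) := by
    have := hφ m _ hx
    simpa [Function.comp_def] using this
  have h2 := aux_indep h1 (p := (φ x).charpoly) (by
    rw [Matrix.charpoly_degree_eq_dim]; simpa using hlt) (Matrix.aeval_self_charpoly _)
  exact (Matrix.charpoly_monic (φ x)).ne_zero h2

open Polynomial in
theorem aux_reg {F D E : Type*} [Field F] [DivisionRing D] [Algebra F D] [FiniteDimensional F D]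
    [Field E] [Algebra F E]
    {n : ℕ} (φ : D →ₐ[F] Matrix (Fin n) (Fin n) E)
    (hφ : ∀ (m : ℕ) (v : Fin m → D), LinearIndependent F v → LinearIndependent E (φ ∘ v))
    {x : D} (hx : LinearIndependent F (fun i : Fin n => x ^ (i : ℕ))) :
    (minpoly F x).natDegree = n ∧
      (φ x).det = algebraMap F E ((-1) ^ n * (minpoly F x).coeff 0) := by
  have hintg : IsIntegral F x := Algebra.IsIntegral.isIntegral x
  have hmon := minpoly.monic hintg
  have hdeg : (minpoly F x).natDegree = n := by
    apply le_antisymm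
    · exact aux_deg_le φ hφ (linearIndependent_pow x)
    · by_contra hlt
      push Not at hlt
      exact hmon.ne_zero (aux_indep hx
        (by rw [degree_eq_natDegree hmon.ne_zero]; exact_mod_cast hlt) (minpoly.aeval F x))
  refine ⟨hdeg, ?_⟩
  have h1 : LinearIndependent E (fun i : Fin n => φ x ^ (i : ℕ)) := by
    have := hφ n _ hx
    simpa [Function.comp_def] using this
  have hd1 : (φ x).charpoly.degree = n := by
    rw [Matrix.charpoly_degree_eq_dim]; simp
  have hd2 : ((minpoly F x).map (algebraMap F E)).degree = n := by
    rw [degree_map, degree_eq_natDegree hmon.ne_zero, hdeg]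
  have h2 : (φ x).charpoly - (minpoly F x).map (algebraMap F E) = 0 := by
    apply aux_indep h1
    · rw [← hd1]
      apply degree_sub_lt_left (by rw [hd1, hd2]) (Matrix.charpoly_monic _).ne_zero
      rw [(Matrix.charpoly_monic _).leadingCoeff, (hmon.map _).leadingCoeff]
    · rw [map_sub, Matrix.aeval_self_charpoly, aeval_map_algebraMap, aeval_algHom_apply,
        minpoly.aeval, map_zero, sub_zero]
  rw [Matrix.det_eq_sign_charpoly_coeff, sub_eq_zero.1 h2, coeff_map]
  simp
theorem aux_smul_reg {F D : Type*} [Field F] [DivisionRing D] [Algebra F D] {n : ℕ} {x : D}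
    (hx : LinearIndependent F (fun i : Fin n => x ^ (i : ℕ))) {c : F} (hc : c ≠ 0) :
    LinearIndependent F (fun i : Fin n => (c • x) ^ (i : ℕ)) := by
  have := hx.units_smul (fun i => (Units.mk0 c hc) ^ (i : ℕ))
  convert this using 2 with i
  simp [smul_pow, Units.smul_def]

open Polynomial in
theorem aux_powexp {F D : Type*} [Field F] [DivisionRing D] [Algebra F D] (g h : D) (i : ℕ) :
    ∃ c : ℕ → D, ∀ s : F, (g + s • h) ^ i = ∑ j ∈ Finset.range (i + 1), s ^ j • c j := by
  induction i with
  | zero => exact ⟨fun _ => 1, fun s => by simp⟩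
  | succ i ih =>
    obtain ⟨c, hc⟩ := ih
    refine ⟨fun j => (if j ≤ i then c j * g else 0) + (if j = 0 then 0 else c (j - 1) * h), fun s => ?_⟩
    rw [pow_succ, hc, mul_add]
    simp only [smul_add, Finset.sum_add_distrib]
    congr 1
    · rw [Finset.sum_range_succ _ (i + 1)]
      simp only [show ¬ (i + 1 ≤ i) by omega, if_false, smul_zero, add_zero, Finset.sum_mul]
      refine Finset.sum_congr rfl fun j hj => ?_
      rw [if_pos (by simpa [Nat.lt_succ_iff] using hj), smul_mul_assoc]
    · rw [Finset.sum_range_succ' _ (i + 1)]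
      simp [Finset.sum_mul, Finset.smul_sum, pow_succ', mul_smul]

open Polynomial in
theorem aux_cofinite {F D : Type*} [Field F] [DivisionRing D] [Algebra F D] {n : ℕ} {g : D}
    (hg : LinearIndependent F (fun i : Fin n => g ^ (i : ℕ))) (h : D) :
    {s : F | ¬ LinearIndependent F (fun i : Fin n => (g + s • h) ^ (i : ℕ))}.Finite := by
  classical
  obtain ⟨L, hL⟩ := LinearMap.exists_leftInverse_of_injective
    (Fintype.linearCombination F (fun i : Fin n => g ^ (i : ℕ)))
    (LinearMap.ker_eq_bot.2 hg.fintypeLinearCombination_injective)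
  have hLg : ∀ i : Fin n, L (g ^ (i : ℕ)) = Pi.single i 1 := by
    intro i
    have := congrArg (fun f => f (Pi.single i 1)) hL
    simpa [Fintype.linearCombination_apply_single] using this
  choose c hc using fun i => aux_powexp (F := F) g h i
  let M : Matrix (Fin n) (Fin n) F[X] := fun i j =>
    ∑ k ∈ Finset.range ((i : ℕ) + 1), C (L (c i k) j) * X ^ k
  have hM : ∀ s : F, ∀ i j, (M i j).eval s = L ((g + s • h) ^ (i : ℕ)) j := by
    intro s i j
    rw [hc]
    simp only [M, eval_finsetSum, eval_mul, eval_C, eval_pow, eval_X, map_sum, map_smul,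
      Finset.sum_apply, Pi.smul_apply, smul_eq_mul]
    exact Finset.sum_congr rfl fun _ _ => mul_comm _ _
  have hdet : ∀ s : F, M.det.eval s = (Matrix.of fun (i j : Fin n) => L ((g + s • h) ^ (i : ℕ)) j).det := by
    intro s
    rw [← coe_evalRingHom, RingHom.map_det]
    congr 1
    ext i j
    simp [hM]
  have h0 : M.det ≠ 0 := by
    intro h0
    have := hdet 0
    rw [h0] at this
    have hone : (Matrix.of fun (i j : Fin n) => L ((g + (0 : F) • h) ^ (i : ℕ)) j) = (1 : Matrix (Fin n) (Fin n) F) := by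
      ext i j
      simp [hLg, Matrix.one_apply, Pi.single_apply, eq_comm]
    rw [hone] at this
    simp at this
  refine (M.det.rootSet_finite F).subset ?_
  intro s hs
  rw [mem_rootSet]
  refine ⟨h0, ?_⟩
  by_contra hne
  apply hs
  rw [Fintype.linearIndependent_iff]
  intro a ha
  have hne' : (Matrix.of fun (i j : Fin n) => L ((g + s • h) ^ (i : ℕ)) j).det ≠ 0 := by
    rw [← hdet]; simpa using hne
  have : a = 0 := by
    apply Matrix.eq_zero_of_vecMul_eq_zero hne'
    ext j
    have := congrArg (fun z => L z j) ha
    simpa [Matrix.vecMul, dotProduct] using this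
  intro i
  rw [this]; rfl

open Polynomial Filter Topology in
/-- density step -/
theorem aux_density {F D E : Type*} [NontriviallyNormedField F] [CompleteSpace F] [CharZero F]
    [DivisionRing D] [Algebra F D] [FiniteDimensional F D]
    [Field E] [Algebra F E]
    {n : ℕ} (hn : 1 ≤ n) (φ : D →ₐ[F] Matrix (Fin n) (Fin n) E)
    (hφ : ∀ (m : ℕ) (v : Fin m → D), LinearIndependent F v → LinearIndependent E (φ ∘ v))
    {g : D} (hg : LinearIndependent F (fun i : Fin n => g ^ (i : ℕ)))
    {h : D} {a : F} (ha : a ≠ 0) (hh : (φ h).det = algebraMap F E a) :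
    ∃ x : D, LinearIndependent F (fun i : Fin n => x ^ (i : ℕ)) ∧
      (φ x).det = algebraMap F E a := by
  classical
  have hreg : ∀ᶠ t : F in 𝓝[≠] 0, LinearIndependent F (fun i : Fin n => (h + t • g) ^ (i : ℕ)) := by
    have hfin := (aux_cofinite hg h).preimage (f := fun t : F => t⁻¹) inv_injective.injOn
    have h1 : ∀ᶠ t : F in 𝓝[≠] 0, t ∉ ((fun t : F => t⁻¹) ⁻¹' {s : F | ¬ LinearIndependent F (fun i : Fin n => (g + s • h) ^ (i : ℕ))}) := by
      have := hfin.isClosed.isOpen_compl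
      have h2 : (((fun t : F => t⁻¹) ⁻¹' {s : F | ¬ LinearIndependent F (fun i : Fin n => (g + s • h) ^ (i : ℕ))}) \ {0})ᶜ ∈ 𝓝 (0 : F) :=
        (hfin.subset Set.sdiff_subset).isClosed.isOpen_compl.mem_nhds (by simp)
      filter_upwards [mem_nhdsWithin_of_mem_nhds h2, self_mem_nhdsWithin] with t ht ht0 hcon
      exact ht ⟨hcon, ht0⟩
    filter_upwards [h1, self_mem_nhdsWithin] with t ht ht0
    have ht0' : t ≠ 0 := ht0
    simp only [Set.mem_preimage, Set.mem_ofPred_eq, not_not] at ht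
    have := aux_smul_reg ht ht0'
    convert this using 3
    rw [smul_add, smul_smul, mul_inv_cancel₀ ht0', one_smul, add_comm]
  obtain ⟨r, hr⟩ := LinearMap.exists_leftInverse_of_injective (Algebra.linearMap F E)
    (LinearMap.ker_eq_bot.2 (algebraMap F E).injective)
  have hr' : ∀ c : F, r (algebraMap F E c) = c := fun c => congrArg (fun f => f c) hr
  let M : Matrix (Fin n) (Fin n) E[X] := (φ h).map C + (X : E[X]) • (φ g).map C
  have hM : ∀ t : F, M.det.eval (algebraMap F E t) = (φ (h + t • g)).det := by
    intro t
    rw [← coe_evalRingHom, RingHom.map_det]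
    congr 1
    ext i j
    simp [M, Matrix.smul_apply]
    rw [Algebra.smul_def, mul_comm]
  let Q : F[X] := ∑ j ∈ Finset.range (M.det.natDegree + 1), C (r (M.det.coeff j)) * X ^ j
  have hQ : ∀ t : F, Q.eval t = r ((φ (h + t • g)).det) := by
    intro t
    rw [← hM, eval_eq_sum_range (p := M.det)]
    simp only [Q, eval_finsetSum, eval_mul, eval_C, eval_pow, eval_X, map_sum]
    refine Finset.sum_congr rfl fun j _ => ?_
    rw [← map_pow, mul_comm (M.det.coeff j), ← Algebra.smul_def, map_smul, smul_eq_mul, mul_comm]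
  have hQ0 : Q.eval 0 = a := by rw [hQ, zero_smul, add_zero, hh, hr']
  have hQreg : ∀ t : F, LinearIndependent F (fun i : Fin n => (h + t • g) ^ (i : ℕ)) →
      (φ (h + t • g)).det = algebraMap F E (Q.eval t) := by
    intro t ht
    rw [hQ, (aux_reg φ hφ ht).2, hr']
  have hpow : ∀ᶠ u : F in 𝓝 1, ∃ l : F, l ^ n = u := by
    have hd : HasStrictDerivAt (fun x : F => x ^ n) ((n : F) * 1 ^ (n - 1)) 1 :=
      hasStrictDerivAt_pow n 1
    have := hd.map_nhds_eq (by simp; omega)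
    rw [one_pow] at this
    rw [← this, eventually_map]
    exact Eventually.of_forall fun x => ⟨x, rfl⟩
  have hcont : Tendsto (fun t : F => Q.eval t / a) (𝓝[≠] 0) (𝓝 1) := by
    have h1 : ContinuousAt (fun t : F => Q.eval t / a) 0 :=
      (Q.continuous.div_const a).continuousAt
    have h2 := h1.tendsto
    simp only [hQ0, div_self ha] at h2
    exact h2.mono_left nhdsWithin_le_nhds
  obtain ⟨t, ht1, l, hl⟩ := (hreg.and (hcont.eventually (hpow.and (eventually_ne_nhds one_ne_zero)))).exists.imp
    (fun t ht => (⟨ht.1, ht.2.1.choose, ht.2.1.choose_spec, ht.2.2⟩ :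
      LinearIndependent F (fun i : Fin n => (h + t • g) ^ (i : ℕ)) ∧ ∃ l : F, l ^ n = Q.eval t / a ∧
        Q.eval t / a ≠ 0))
  obtain ⟨hl, hne⟩ := hl
  have hl0 : l ≠ 0 := by
    rintro rfl
    rw [zero_pow (by omega)] at hl
    exact hne hl.symm
  refine ⟨l⁻¹ • (h + t • g), aux_smul_reg ht1 (inv_ne_zero hl0), ?_⟩
  have hQt : Q.eval t ≠ 0 := fun h0 => hne (by rw [h0, zero_div])
  rw [map_smul, Matrix.det_smul_of_tower, hQreg t ht1, Fintype.card_fin, inv_pow, hl,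
    Algebra.smul_def, ← map_mul]
  congr 1
  field_simp
open Polynomial in
theorem aux_norm {F D E : Type*} [NontriviallyNormedField F] [CompleteSpace F] [IsUltrametricDist F]
    [DivisionRing D] [Algebra F D] [FiniteDimensional F D]
    [Field E] [Algebra F E] [IsAlgClosed E] [Algebra.IsAlgebraic F E]
    {n : ℕ} (hn : 1 ≤ n) (φ : D →ₐ[F] Matrix (Fin n) (Fin n) E) :
    ∃ N : D → ℝ, (∀ x, 0 ≤ N x) ∧ N 0 = 0 ∧ (∀ x, N x = 0 → x = 0) ∧ (∀ x y, N (x * y) = N x * N y) ∧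
      (∀ x y, N (x + y) ≤ max (N x) (N y)) ∧ (∀ c : F, N (algebraMap F D c) = ‖c‖) := by
  have hroot : ∀ (x : D) (l : E), (φ x).charpoly.IsRoot l →
      spectralMulAlgNorm F E l = spectralValue (minpoly F x) := by
    intro x l hl
    have hintg : IsIntegral F x := Algebra.IsIntegral.isIntegral x
    have h1 := Matrix.mem_spectrum_iff_isRoot_charpoly.2 hl
    have h2 := spectrum.subset_polynomial_aeval (φ x) ((minpoly F x).map (algebraMap F E)) ⟨l, h1, rfl⟩
    rw [aeval_map_algebraMap, aeval_algHom_apply, minpoly.aeval, map_zero] at h2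
    have : NeZero n := ⟨by omega⟩
    rw [spectrum.zero_eq] at h2
    have h3 : aeval l (minpoly F x) = 0 := by
      simpa [eval_map_algebraMap] using h2
    rw [spectralMulAlgNorm_def, spectralNorm,
      minpoly.eq_of_irreducible_of_monic (minpoly.irreducible hintg) h3 (minpoly.monic hintg)]
  have hcard : ∀ x : D, (φ x).charpoly.roots.card = n := by
    intro x
    rw [splits_iff_card_roots.1 (IsAlgClosed.splits _), Matrix.charpoly_natDegree_eq_dim]
    simp
  have hex : ∀ x : D, ∃ l : E, (φ x).charpoly.IsRoot l := by
    intro x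
    have : (φ x).charpoly.roots ≠ 0 := by
      rw [← Multiset.card_pos, hcard]; omega
    obtain ⟨l, hl⟩ := Multiset.exists_mem_of_ne_zero this
    exact ⟨l, isRoot_of_mem_roots hl⟩
  have hdet : ∀ x : D, spectralMulAlgNorm F E (φ x).det = spectralValue (minpoly F x) ^ n := by
    intro x
    rw [Matrix.det_eq_prod_roots_charpoly, map_multiset_prod]
    rw [Multiset.map_congr rfl (g := fun _ => spectralValue (minpoly F x))]
    · simp [hcard]
    · intro l hl
      exact hroot x l (isRoot_of_mem_roots hl)
  have hnn : ∀ x : D, 0 ≤ spectralValue (minpoly F x) := fun x => spectralValue_nonneg _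
  have hmul : ∀ x y : D, spectralValue (minpoly F (x * y)) =
      spectralValue (minpoly F x) * spectralValue (minpoly F y) := by
    intro x y
    refine (pow_left_inj₀ (hnn _) (mul_nonneg (hnn _) (hnn _)) (n := n) (by omega)).1 ?_
    rw [mul_pow, ← hdet, ← hdet, ← hdet, map_mul, Matrix.det_mul, map_mul]
  have hF : ∀ c : F, spectralValue (minpoly F (algebraMap F D c)) = ‖c‖ := by
    intro c
    rw [minpoly.eq_X_sub_C_of_algebraMap_inj _ (algebraMap F D).injective, spectralValue_X_sub_C]
  have h0 : spectralValue (minpoly F (0 : D)) = 0 := by simpa using hF 0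
  have h1 : spectralValue (minpoly F (1 : D)) = 1 := by simpa using hF 1
  have h00 : ∀ x : D, spectralValue (minpoly F x) = 0 → x = 0 := by
    intro x hx
    by_contra hne
    have := hmul x x⁻¹
    rw [mul_inv_cancel₀ hne, hx, h1] at this
    simp at this
  have hadd1 : ∀ x : D, spectralValue (minpoly F (1 + x)) ≤ max 1 (spectralValue (minpoly F x)) := by
    intro x
    obtain ⟨l, hl⟩ := hex x
    have hl' : (φ (1 + x)).charpoly.IsRoot (1 + l) := by
      rw [← Matrix.mem_spectrum_iff_isRoot_charpoly] at hl ⊢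
      rw [map_add, map_one]
      have := spectrum.add_mem_add_iff (r := l) (s := (1 : E)) (a := φ x)
      simpa [add_comm] using this.2 hl
    rw [← hroot x l hl, ← hroot _ _ hl']
    have := isNonarchimedean_spectralNorm (K := F) (L := E) 1 l
    rwa [spectralNorm_one] at this
  refine ⟨fun x => spectralValue (minpoly F x), hnn, h0, h00, hmul, ?_, hF⟩
  intro x y
  by_cases hx : x = 0
  · subst hx; simp
  have : x + y = x * (1 + x⁻¹ * y) := by
    rw [mul_add, mul_one, mul_inv_cancel_left₀ hx]
  dsimp only
  rw [this, hmul]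
  calc _ ≤ spectralValue (minpoly F x) * max 1 (spectralValue (minpoly F (x⁻¹ * y))) :=
        mul_le_mul_of_nonneg_left (hadd1 _) (hnn _)
    _ = _ := by
      rw [mul_max_of_nonneg _ _ (hnn _), mul_one, ← hmul, mul_inv_cancel_left₀ hx]
theorem aux_unif (D : Type*) [NormedDivisionRing D] [IsUltrametricDist D] [ProperSpace D]
    (hnt : ∃ x : D, x ≠ 0 ∧ ‖x‖ < 1) :
    ∃ P : D, 0 < ‖P‖ ∧ ‖P‖ < 1 ∧ (∀ x : D, ‖x‖ < 1 → ‖x‖ ≤ ‖P‖) ∧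
      ∀ x : D, x ≠ 0 → ∃ i : ℤ, ‖x‖ = ‖P‖ ^ i := by
  have hcomp : IsCompact (Metric.ball (0 : D) 1) :=
    Metric.isCompact_of_isClosed_isBounded (IsUltrametricDist.isClosed_ball 0 1) Metric.isBounded_ball
  obtain ⟨P, hP, hmax⟩ := hcomp.exists_isMaxOn ⟨0, by simp⟩ (continuous_norm.continuousOn)
  have hP1 : ‖P‖ < 1 := by simpa using hP
  have hmax' : ∀ x : D, ‖x‖ < 1 → ‖x‖ ≤ ‖P‖ := fun x hx => hmax (by simpa using hx)
  have hP0 : 0 < ‖P‖ := by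
    obtain ⟨x, hx0, hx1⟩ := hnt
    exact (norm_pos_iff.2 hx0).trans_le (hmax' x hx1)
  refine ⟨P, hP0, hP1, hmax', fun x hx => ?_⟩
  obtain ⟨i, hi1, hi2⟩ := exists_mem_Ioc_zpow (norm_pos_iff.2 hx) (one_lt_inv₀ hP0 |>.2 hP1)
  refine ⟨-(i + 1), ?_⟩
  rw [inv_zpow', ] at hi1 hi2
  have hpos : 0 < ‖P‖ ^ (-(i + 1)) := zpow_pos hP0 _
  apply le_antisymm hi2
  by_contra hlt
  push Not at hlt
  have h1 : ‖x * (P ^ (-(i + 1)))⁻¹‖ < 1 := by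
    rw [norm_mul, norm_inv, norm_zpow, ← div_eq_mul_inv, div_lt_one hpos]
    exact hlt
  have h2 := hmax' _ h1
  rw [norm_mul, norm_inv, norm_zpow, ← div_eq_mul_inv, div_le_iff₀ hpos] at h2
  have h3 : ‖P‖ * ‖P‖ ^ (-(i + 1)) = ‖P‖ ^ (-i) := by
    rw [← zpow_one_add₀ hP0.ne']; congr 1; ring
  rw [h3] at h2
  exact absurd hi1 (not_lt.2 h2)

def auxO (D : Type*) [NormedDivisionRing D] [IsUltrametricDist D] : Subring D where
  carrier := {x | ‖x‖ ≤ 1}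
  mul_mem' {a b} ha hb := by
    change ‖a * b‖ ≤ 1
    rw [norm_mul]; exact mul_le_one₀ ha (norm_nonneg _) hb
  one_mem' := by change ‖(1 : D)‖ ≤ 1; simp
  add_mem' {a b} ha hb := by
    change ‖a + b‖ ≤ 1
    exact (IsUltrametricDist.norm_add_le_max a b).trans (max_le ha hb)
  zero_mem' := by change ‖(0 : D)‖ ≤ 1; simp
  neg_mem' {a} ha := by change ‖-a‖ ≤ 1; rw [norm_neg]; exact ha

theorem aux_mem_O {D : Type*} [NormedDivisionRing D] [IsUltrametricDist D] {x : D} :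
    x ∈ auxO D ↔ ‖x‖ ≤ 1 := Iff.rfl

def auxM (D : Type*) [NormedDivisionRing D] [IsUltrametricDist D] : Ideal (auxO D) where
  carrier := {x | ‖(x : D)‖ < 1}
  add_mem' {a b} ha hb := by
    change ‖(a : D) + b‖ < 1
    exact (IsUltrametricDist.norm_add_le_max (a : D) b).trans_lt (max_lt ha hb)
  zero_mem' := by change ‖((0 : auxO D) : D)‖ < 1; simp
  smul_mem' c {x} hx := by
    change ‖(c : D) * x‖ < 1
    rw [norm_mul]
    exact (mul_le_of_le_one_left (norm_nonneg _) c.2).trans_lt hx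

theorem aux_mem_M {D : Type*} [NormedDivisionRing D] [IsUltrametricDist D] {x : auxO D} :
    x ∈ auxM D ↔ ‖(x : D)‖ < 1 := Iff.rfl

theorem aux_residue.{u} (D : Type u) [NormedDivisionRing D] [IsUltrametricDist D] [ProperSpace D] :
    ∃ (l : Type u) (_ : Field l) (_ : Finite l) (ρ : auxO D →+* l), Function.Surjective ρ ∧
      ∀ x : auxO D, ρ x = 0 ↔ ‖(x : D)‖ < 1 := by
  have h2 : (auxM D).IsTwoSided := ⟨fun {a} b ha => by
    change ‖(a : D) * b‖ < 1
    rw [norm_mul]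
    exact (mul_le_of_le_one_right (norm_nonneg _) b.2).trans_lt ha⟩
  have hz : ∀ x : auxO D, Ideal.Quotient.mk (auxM D) x = 0 ↔ ‖(x : D)‖ < 1 := fun x =>
    Ideal.Quotient.eq_zero_iff_mem
  have hsurj : Function.Surjective (Ideal.Quotient.mk (auxM D)) := Ideal.Quotient.mk_surjective
  have hnt : Nontrivial (auxO D ⧸ auxM D) := by
    refine ⟨1, 0, ?_⟩
    rw [← map_one (Ideal.Quotient.mk (auxM D)), Ne, hz]
    simp
  have hnzd : NoZeroDivisors (auxO D ⧸ auxM D) := by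
    refine ⟨fun {a b} hab => ?_⟩
    obtain ⟨a, rfl⟩ := hsurj a
    obtain ⟨b, rfl⟩ := hsurj b
    rw [← map_mul, hz] at hab
    rw [hz, hz]
    by_contra hcon
    push Not at hcon
    have : ‖(a : D) * b‖ < 1 := hab
    rw [norm_mul] at this
    nlinarith [hcon.1, hcon.2]
  have hdom : IsDomain (auxO D ⧸ auxM D) := NoZeroDivisors.to_isDomain _
  have hfin : Finite (auxO D ⧸ auxM D) := by
    have hcomp : IsCompact (Metric.closedBall (0 : D) 1) := isCompact_closedBall 0 1
    obtain ⟨t, ht, hfint, hcov⟩ := hcomp.finite_cover_balls (e := 1) one_pos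
    have htO : ∀ x ∈ t, x ∈ auxO D := fun x hx => by
      have := ht hx
      rw [aux_mem_O]; simpa using this
    have : Finite t := hfint
    refine Finite.of_surjective (fun x : t => Ideal.Quotient.mk (auxM D) ⟨x.1, htO x.1 x.2⟩) ?_
    intro y
    obtain ⟨y, rfl⟩ := hsurj y
    have hy : (y : D) ∈ Metric.closedBall (0 : D) 1 := by simpa using aux_mem_O.1 y.2
    have := hcov hy
    simp only [Set.mem_iUnion] at this
    obtain ⟨x, hx, hxy⟩ := this
    refine ⟨⟨x, hx⟩, ?_⟩
    rw [eq_comm, ← sub_eq_zero, ← map_sub, hz]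
    simpa [dist_eq_norm] using hxy
  exact ⟨auxO D ⧸ auxM D, (Finite.isDomain_to_isField _).toField, hfin, Ideal.Quotient.mk (auxM D), hsurj, hz⟩

theorem aux_residue2.{u, v} (F : Type u) (D : Type v) [NontriviallyNormedField F] [IsUltrametricDist F] [ProperSpace F]
    [NormedDivisionRing D] [NormedAlgebra F D] [IsUltrametricDist D] [ProperSpace D] :
    ∃ (k : Type u) (_ : Field k) (_ : Finite k) (l : Type v) (_ : Field l) (_ : Finite l)
      (_ : Algebra k l) (ι : auxO F →+* auxO D) (σ : auxO F →+* k) (ρ : auxO D →+* l),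
      (∀ c, ((ι c : auxO D) : D) = algebraMap F D c) ∧
      Function.Surjective σ ∧ Function.Surjective ρ ∧
      (∀ x : auxO F, σ x = 0 ↔ ‖(x : F)‖ < 1) ∧
      (∀ x : auxO D, ρ x = 0 ↔ ‖(x : D)‖ < 1) ∧
      ∀ c, ρ (ι c) = algebraMap k l (σ c) := by
  obtain ⟨k, _, _, σ, hσ, hσ0⟩ := aux_residue F
  obtain ⟨l, _, _, ρ, hρ, hρ0⟩ := aux_residue D
  let ι : auxO F →+* auxO D := ((algebraMap F D).comp (auxO F).subtype).codRestrict (auxO D) (by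
    intro x
    rw [aux_mem_O]
    simpa using aux_mem_O.1 x.2)
  have hι : ∀ c, ((ι c : auxO D) : D) = algebraMap F D c := fun c => rfl
  let τ : k →+* l := RingHom.liftOfSurjective σ hσ ⟨ρ.comp ι, by
    intro x hx
    rw [RingHom.mem_ker] at hx ⊢
    rw [RingHom.comp_apply, hρ0, hι]
    simpa using (hσ0 x).1 hx⟩
  let _ := τ.toAlgebra
  refine ⟨k, _, inferInstance, l, _, inferInstance, inferInstance, ι, σ, ρ, hι, hσ, hρ, hσ0, hρ0, ?_⟩
  intro c
  rw [RingHom.algebraMap_toAlgebra]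
  have := RingHom.liftOfRightInverse_comp_apply σ _ (Function.rightInverse_surjInv hσ)
    (⟨ρ.comp ι, by
      intro x hx
      rw [RingHom.mem_ker] at hx ⊢
      rw [RingHom.comp_apply, hρ0, hι]
      simpa using (hσ0 x).1 hx⟩ : {g : auxO F →+* l // RingHom.ker σ ≤ RingHom.ker g}) c
  exact this.symm
theorem aux_taylor_pow {D : Type*} [NormedDivisionRing D] [IsUltrametricDist D] {x y : D}
    (hxy : Commute x y) (hx : ‖x‖ ≤ 1) (hy : ‖y‖ ≤ 1) (k : ℕ) :
    ‖(x + y) ^ k - x ^ k - (k : D) * x ^ (k - 1) * y‖ ≤ ‖y‖ ^ 2 := by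
  induction k with
  | zero => simp
  | succ k ih =>
    have h1 : (x + y) ^ (k + 1) - x ^ (k + 1) - ((k + 1 : ℕ) : D) * x ^ (k + 1 - 1) * y =
        (x + y) * ((x + y) ^ k - x ^ k - (k : D) * x ^ (k - 1) * y) + (k : D) * x ^ (k - 1) * y ^ 2 := by
      have hc1 : ∀ m, y * x ^ m = x ^ m * y := fun m => ((hxy.pow_left m).eq).symm
      have hk : x * ((k : D) * x ^ (k - 1)) = k * x ^ k := by
        rcases k with _ | k
        · simp
        · rw [Nat.add_sub_cancel, ← mul_assoc, ← (Nat.cast_commute (k + 1) x).eq, mul_assoc, ← pow_succ']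
      have hk2 : y * ((k : D) * x ^ (k - 1)) = (k * x ^ (k - 1)) * y := by
        rw [← mul_assoc, ← (Nat.cast_commute k y).eq, mul_assoc, hc1, mul_assoc]
      rw [Nat.add_sub_cancel, mul_sub, mul_sub, ← pow_succ', ← mul_assoc (x + y) _ y, add_mul x y, add_mul x y,
        hk, hk2, ← pow_succ', hc1]
      push_cast
      rw [sq]
      noncomm_ring
    rw [h1]
    refine (IsUltrametricDist.norm_add_le_max _ _).trans (max_le ?_ ?_)
    · rw [norm_mul]
      have : ‖x + y‖ ≤ 1 := (IsUltrametricDist.norm_add_le_max _ _).trans (max_le hx hy)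
      exact (mul_le_of_le_one_left (norm_nonneg _) this).trans ih
    · rw [norm_mul, norm_mul, norm_pow, norm_pow]
      have h2 : ‖(k : D)‖ ≤ 1 := IsUltrametricDist.norm_natCast_le_one D k
      exact mul_le_of_le_one_left (by positivity) (mul_le_one₀ h2 (by positivity) (pow_le_one₀ (norm_nonneg _) hx))

open Polynomial in
theorem aux_taylor {F D : Type*} [NontriviallyNormedField F]
    [NormedDivisionRing D] [NormedAlgebra F D] [IsUltrametricDist D] {x y : D}
    (hxy : Commute x y) (hx : ‖x‖ ≤ 1) (hy : ‖y‖ ≤ 1) (p : F[X]) (hp : ∀ i, ‖p.coeff i‖ ≤ 1) :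
    ‖aeval (x + y) p - aeval x p - aeval x (derivative p) * y‖ ≤ ‖y‖ ^ 2 := by
  let T : F[X] →ₗ[F] D := (aeval (x + y)).toLinearMap - (aeval x).toLinearMap -
    (LinearMap.mulRight F y) ∘ₗ (aeval x).toLinearMap ∘ₗ derivative
  have hT : T p = ∑ i ∈ Finset.range (p.natDegree + 1), p.coeff i • T (X ^ i) := by
    conv_lhs => rw [p.as_sum_range_C_mul_X_pow]
    simp only [map_sum, ← smul_eq_C_mul, map_smul]
  have hT' : T p = aeval (x + y) p - aeval x p - aeval x (derivative p) * y := rfl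
  rw [← hT', hT]
  apply IsUltrametricDist.norm_sum_le_of_forall_le_of_nonneg (by positivity)
  intro i _
  rw [norm_smul]
  refine (mul_le_of_le_one_left (norm_nonneg _) (hp i)).trans ?_
  have : T (X ^ i) = (x + y) ^ i - x ^ i - (i : D) * x ^ (i - 1) * y := by
    simp [T, derivative_X_pow]
  rw [this]
  exact aux_taylor_pow hxy hx hy i

open Polynomial in
theorem aux_hensel {F D : Type*} [NontriviallyNormedField F] [IsUltrametricDist F]
    [NormedDivisionRing D] [NormedAlgebra F D] [IsUltrametricDist D] [ProperSpace D]
    (p : F[X]) (hp : ∀ i, ‖p.coeff i‖ ≤ 1) (α : D) (hα : ‖α‖ ≤ 1)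
    (h0 : ‖aeval α p‖ < 1) (h1 : ‖aeval α (derivative p)‖ = 1) :
    ∃ β : D, ‖β - α‖ < 1 ∧ aeval β p = 0 := by
  let S := Subalgebra.centralizer F (Set.centralizer {α})
  have hαC : α ∈ Set.centralizer {α} := by simp [Set.mem_centralizer_iff]
  have hαS : α ∈ S := by
    rw [Subalgebra.mem_centralizer_iff]
    intro g hg
    exact (Set.mem_centralizer_iff.1 hg α rfl).symm
  have hcomm : ∀ x ∈ S, ∀ y ∈ S, Commute x y := by
    intro x hx y hy
    rw [Subalgebra.mem_centralizer_iff] at hx hy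
    have hxC : x ∈ Set.centralizer {α} := by
      rw [Set.mem_centralizer_iff]
      intro m hm
      rw [Set.mem_singleton_iff.1 hm]
      exact hx α hαC
    exact hy x hxC
  have hinv : ∀ x ∈ S, x⁻¹ ∈ S := by
    intro x hx
    exact Set.inv_mem_centralizer₀ hx
  have haev : ∀ x ∈ S, ∀ q : F[X], aeval x q ∈ S := by
    intro x hx q
    rw [aeval_eq_sum_range]
    exact S.sum_mem fun i _ => S.smul_mem (S.pow_mem hx i) _
  have hclosed : IsClosed (S : Set D) := by
    have : (S : Set D) = Set.centralizer (Set.centralizer {α}) := rfl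
    rw [this]
    exact Set.isClosed_centralizer _
  have hcomp : IsCompact (Metric.closedBall α ‖aeval α p‖ ∩ (S : Set D)) :=
    (isCompact_closedBall _ _).inter_right hclosed
  obtain ⟨x, ⟨hxb, hxS⟩, hmin⟩ := hcomp.exists_isMinOn ⟨α, by simp, hαS⟩
    (f := fun x => ‖aeval x p‖) (by fun_prop)
  have hxb' : ‖x - α‖ ≤ ‖aeval α p‖ := by simpa [dist_eq_norm] using hxb
  have hx1 : ‖x‖ ≤ 1 := by
    have := IsUltrametricDist.norm_add_le_max (x - α) α
    rw [sub_add_cancel] at this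
    exact this.trans (max_le (hxb'.trans h0.le) hα)
  have hpx : ‖aeval x p‖ ≤ ‖aeval α p‖ := hmin ⟨by simp, hαS⟩
  have hder : ∀ i, ‖(derivative p).coeff i‖ ≤ 1 := by
    intro i
    rw [coeff_derivative, norm_mul]
    refine mul_le_one₀ (hp _) (norm_nonneg _) ?_
    have := IsUltrametricDist.norm_natCast_le_one F (i + 1)
    simpa using this
  have hintg : ∀ q : F[X], (∀ i, ‖q.coeff i‖ ≤ 1) → ∀ z : D, ‖z‖ ≤ 1 → ‖aeval z q‖ ≤ 1 := by
    intro q hq z hz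
    rw [aeval_eq_sum_range]
    apply IsUltrametricDist.norm_sum_le_of_forall_le_of_nonneg zero_le_one
    intro i _
    rw [norm_smul, norm_pow]
    exact mul_le_one₀ (hq i) (by positivity) (pow_le_one₀ (norm_nonneg _) hz)
  have hderder : ∀ i, ‖(derivative (derivative p)).coeff i‖ ≤ 1 := by
    intro i
    rw [coeff_derivative, norm_mul]
    refine mul_le_one₀ (hder _) (norm_nonneg _) ?_
    have := IsUltrametricDist.norm_natCast_le_one F (i + 1)
    simpa using this
  have hdx : ‖aeval x (derivative p)‖ = 1 := by
    have hlt : ‖x - α‖ < 1 := hxb'.trans_lt h0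
    have ht := aux_taylor (hcomm α hαS (x - α) (S.sub_mem hxS hαS)) hα hlt.le (derivative p) hder
    rw [add_sub_cancel] at ht
    have hA : ‖aeval x (derivative p) - aeval α (derivative p)‖ < 1 := by
      have := IsUltrametricDist.norm_add_le_max
        (aeval x (derivative p) - aeval α (derivative p) - aeval α (derivative (derivative p)) * (x - α))
        (aeval α (derivative (derivative p)) * (x - α))
      rw [sub_add_cancel] at this
      refine this.trans_lt (max_lt (ht.trans_lt (pow_lt_one₀ (norm_nonneg _) hlt two_ne_zero)) ?_)
      rw [norm_mul]
      exact (mul_le_of_le_one_left (norm_nonneg _) (hintg _ hderder α hα)).trans_lt hlt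
    have := IsUltrametricDist.norm_add_eq_max_of_norm_ne_norm
      (x := aeval x (derivative p) - aeval α (derivative p)) (y := aeval α (derivative p))
      (by rw [h1]; exact hA.ne)
    rw [sub_add_cancel, h1, max_eq_right hA.le] at this
    exact this
  refine ⟨x, hxb'.trans_lt h0, ?_⟩
  by_contra hne
  set y := -((aeval x (derivative p))⁻¹ * aeval x p) with hy
  have hdne : aeval x (derivative p) ≠ 0 := by
    rw [← norm_pos_iff, hdx]; exact one_pos
  have hyn : ‖y‖ = ‖aeval x p‖ := by
    rw [hy, norm_neg, norm_mul, norm_inv, hdx]; simp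
  have hyS : y ∈ S := S.neg_mem (S.mul_mem (hinv _ (haev x hxS _)) (haev x hxS _))
  have ht := aux_taylor (hcomm x hxS y hyS) hx1 (by rw [hyn]; exact hpx.trans h0.le) p hp
  have hz : aeval x p + aeval x (derivative p) * y = 0 := by
    rw [hy, mul_neg, mul_inv_cancel_left₀ hdne, add_neg_cancel]
  rw [sub_sub, hz, sub_zero, hyn] at ht
  have hm : ‖aeval x p‖ ≤ ‖aeval (x + y) p‖ := by
    refine hmin ⟨?_, S.add_mem hxS hyS⟩
    rw [Metric.mem_closedBall, dist_eq_norm, add_sub_right_comm]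
    exact (IsUltrametricDist.norm_add_le_max _ _).trans (max_le hxb' (by rw [hyn]; exact hpx))
  have hpos : 0 < ‖aeval x p‖ := norm_pos_iff.2 hne
  have hl1 : ‖aeval x p‖ < 1 := hpx.trans_lt h0
  nlinarith
theorem aux_two {D ι : Type*} [NormedDivisionRing D] [IsUltrametricDist D] (s : Finset ι) (f : ι → D)
    (hs : ∑ i ∈ s, f i = 0) (hne : ∃ i ∈ s, f i ≠ 0) :
    ∃ i ∈ s, ∃ j ∈ s, i ≠ j ∧ f i ≠ 0 ∧ f j ≠ 0 ∧ ‖f i‖ = ‖f j‖ := by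
  classical
  by_contra hcon
  push Not at hcon
  have hsum : ∑ i ∈ s with f i ≠ 0, f i = 0 := by
    rw [Finset.sum_filter_ne_zero, hs]
  obtain ⟨i, his, hi⟩ := hne
  have hnon : (s.filter (fun i => f i ≠ 0)).Nonempty := ⟨i, by simp [his, hi]⟩
  have := IsUltrametricDist.norm_sum_eq_sup'_of_pairwise_ne (s := s.filter (fun i => f i ≠ 0)) (f := f) hnon (by
    intro a ha b hb hab
    simp only [Finset.coe_filter, Set.mem_ofPred_eq] at ha hb
    exact hcon a ha.1 b hb.1 hab ha.2 hb.2)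
  rw [hsum, norm_zero] at this
  have h2 := Finset.le_sup' (fun i => ‖f i‖) (show i ∈ s.filter (fun i => f i ≠ 0) by simp [his, hi])
  rw [← this] at h2
  exact hi (norm_le_zero_iff.1 h2)

/-- valuations of `c P^i` determine `i` modulo `e`. -/
theorem aux_dvd {F D : Type*} [NontriviallyNormedField F] [NormedDivisionRing D] [NormedAlgebra F D]
    {P : D} {w : F} (hP0 : 0 < ‖P‖) (hP1 : ‖P‖ < 1) (hw : ∀ x : F, x ≠ 0 → ∃ i : ℤ, ‖x‖ = ‖w‖ ^ i)
    {e : ℕ} (he : ‖w‖ = ‖P‖ ^ e) {c d : F} (hc : c ≠ 0) (hd : d ≠ 0) {i j : ℕ}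
    (h : ‖c • P ^ i‖ = ‖d • P ^ j‖) : ∃ s t : ℤ, ‖c‖ = ‖w‖ ^ s ∧ ‖d‖ = ‖w‖ ^ t ∧ (e : ℤ) * s + i = e * t + j := by
  obtain ⟨s, hs⟩ := hw c hc
  obtain ⟨t, ht⟩ := hw d hd
  refine ⟨s, t, hs, ht, ?_⟩
  rw [norm_smul, norm_smul, norm_pow, norm_pow, hs, ht, he, ← zpow_natCast, ← zpow_natCast ‖P‖ i,
    ← zpow_natCast ‖P‖ j, ← zpow_mul, ← zpow_mul, ← zpow_add₀ hP0.ne', ← zpow_add₀ hP0.ne'] at h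
  exact zpow_right_injective₀ hP0 hP1.ne h

theorem aux_LI_P {F D : Type*} [NontriviallyNormedField F] [NormedDivisionRing D] [NormedAlgebra F D]
    [IsUltrametricDist D]
    {P : D} {w : F} (hP0 : 0 < ‖P‖) (hP1 : ‖P‖ < 1) (hw : ∀ x : F, x ≠ 0 → ∃ i : ℤ, ‖x‖ = ‖w‖ ^ i)
    {e : ℕ} (he : ‖w‖ = ‖P‖ ^ e) : LinearIndependent F (fun i : Fin e => P ^ (i : ℕ)) := by
  rw [Fintype.linearIndependent_iff]
  intro g hg
  by_contra hne
  push Not at hne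
  obtain ⟨i, hi⟩ := hne
  have hP : ∀ m : ℕ, P ^ m ≠ 0 := fun m => pow_ne_zero _ (norm_pos_iff.1 hP0)
  obtain ⟨a, -, b, -, hab, ha, hb, hn⟩ := aux_two _ _ hg ⟨i, Finset.mem_univ _, smul_ne_zero hi (hP _)⟩
  have ha' : g a ≠ 0 := fun h => ha (by rw [h, zero_smul])
  have hb' : g b ≠ 0 := fun h => hb (by rw [h, zero_smul])
  obtain ⟨s, t, -, -, h⟩ := aux_dvd hP0 hP1 hw he ha' hb' hn
  apply hab
  ext
  have h1 := a.2
  have h2 := b.2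
  have h3 : ((a : ℕ) : ℤ) % e = ((b : ℕ) : ℤ) % e := by
    have := congrArg (· % (e : ℤ)) h
    simpa [Int.add_emod] using this
  rw [Int.emod_eq_of_lt (by positivity) (by exact_mod_cast h1),
    Int.emod_eq_of_lt (by positivity) (by exact_mod_cast h2)] at h3
  exact_mod_cast h3

open Polynomial in
theorem aux_coeff0 {F D : Type*} [NontriviallyNormedField F] [NormedDivisionRing D] [NormedAlgebra F D]
    [IsUltrametricDist D] [FiniteDimensional F D]
    {P : D} {w : F} (hP0 : 0 < ‖P‖) (hP1 : ‖P‖ < 1) (hw : ∀ x : F, x ≠ 0 → ∃ i : ℤ, ‖x‖ = ‖w‖ ^ i)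
    {e : ℕ} (he1 : 1 ≤ e) (he : ‖w‖ = ‖P‖ ^ e) (hdeg : (minpoly F P).natDegree = e) :
    ‖(minpoly F P).coeff 0‖ = ‖w‖ := by
  have hintg : IsIntegral F P := Algebra.IsIntegral.isIntegral P
  have hP : ∀ m : ℕ, P ^ m ≠ 0 := fun m => pow_ne_zero _ (norm_pos_iff.1 hP0)
  have h0 := minpoly.aeval F P
  have hlead : (minpoly F P).coeff e = 1 := by
    have := (minpoly.monic hintg).coeff_natDegree
    rwa [hdeg] at this
  rw [aeval_eq_sum_range, hdeg] at h0
  obtain ⟨a, ha1, b, hb1, hab, ha, hb, hn⟩ := aux_two _ _ h0 ⟨e, by simp, by rw [hlead]; simpa using hP e⟩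
  have key : ∀ a ∈ Finset.range (e + 1), ∀ b ∈ Finset.range (e + 1), a < b →
      (minpoly F P).coeff a • P ^ a ≠ 0 → (minpoly F P).coeff b • P ^ b ≠ 0 →
      ‖(minpoly F P).coeff a • P ^ a‖ = ‖(minpoly F P).coeff b • P ^ b‖ →
      ‖(minpoly F P).coeff 0‖ = ‖w‖ := by
    intro a ha1 b hb1 hab ha hb hn
    have ha' : (minpoly F P).coeff a ≠ 0 := fun h => ha (by rw [h, zero_smul])
    have hb' : (minpoly F P).coeff b ≠ 0 := fun h => hb (by rw [h, zero_smul])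
    obtain ⟨s, t, -, -, h⟩ := aux_dvd hP0 hP1 hw he ha' hb' hn
    simp only [Finset.mem_range] at ha1 hb1
    have hdv : (e : ℤ) ∣ ((b - a : ℕ) : ℤ) := ⟨s - t, by rw [Nat.cast_sub hab.le]; linear_combination -h⟩
    have hle : e ≤ b - a := Nat.le_of_dvd (by omega) (by exact_mod_cast hdv)
    have hbe : b = e := by omega
    have ha0 : a = 0 := by omega
    subst hbe ha0
    rw [hlead] at hn
    simp only [pow_zero, one_smul, norm_smul, norm_one, mul_one] at hn
    rw [hn, he, norm_pow]
  rcases lt_or_gt_of_ne hab with h | h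
  · exact key a ha1 b hb1 h ha hb hn
  · exact key b hb1 a ha1 h hb ha hn.symm
theorem aux_LI_res {F D k l : Type*} [NontriviallyNormedField F] [IsUltrametricDist F]
    [NormedDivisionRing D] [NormedAlgebra F D] [IsUltrametricDist D] [Field k] [Field l] [Algebra k l]
    (ι : auxO F →+* auxO D) (σ : auxO F →+* k) (ρ : auxO D →+* l)
    (hι : ∀ c, ((ι c : auxO D) : D) = algebraMap F D c)
    (hc : ∀ c, ρ (ι c) = algebraMap k l (σ c)) {m : ℕ} (v : Fin m → auxO D)
    (hv : LinearIndependent k (fun i => ρ (v i))) : LinearIndependent F (fun i => (v i : D)) := by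
  rw [Fintype.linearIndependent_iff] at hv ⊢
  intro g hg
  by_contra hne
  push Not at hne
  obtain ⟨i, hi⟩ := hne
  have : Nonempty (Fin m) := ⟨i⟩
  obtain ⟨i0, hmax⟩ := Finite.exists_max (fun i => ‖g i‖)
  have h0 : g i0 ≠ 0 := by
    intro h
    have := hmax i
    rw [h, norm_zero] at this
    exact hi (norm_le_zero_iff.1 this)
  let d : Fin m → auxO F := fun i => ⟨g i / g i0, by
    rw [aux_mem_O, norm_div]
    exact div_le_one_of_le₀ (hmax i) (norm_nonneg _)⟩
  have hsum : ∑ i, ι (d i) * v i = 0 := by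
    apply Subtype.ext
    have : ((∑ i, ι (d i) * v i : auxO D) : D) = (g i0)⁻¹ • ∑ i, g i • (v i : D) := by
      rw [Finset.smul_sum]
      push_cast
      refine Finset.sum_congr rfl fun i _ => ?_
      rw [hι, smul_smul, Algebra.smul_def, ← div_eq_inv_mul]
    rw [this, hg, smul_zero]; rfl
  have h1 := congrArg ρ hsum
  simp only [map_sum, map_mul, hc, ← Algebra.smul_def, map_zero] at h1
  have h2 := hv _ h1 i0
  have h3 : d i0 = 1 := Subtype.ext (div_self h0)
  rw [h3, map_one] at h2
  exact one_ne_zero h2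

theorem aux_span {F D k l : Type*} [NontriviallyNormedField F] [IsUltrametricDist F] [ProperSpace F]
    [NormedDivisionRing D] [NormedAlgebra F D] [IsUltrametricDist D] [FiniteDimensional F D]
    [Field k] [Field l] [Algebra k l]
    (ι : auxO F →+* auxO D) (σ : auxO F →+* k) (ρ : auxO D →+* l)
    (hι : ∀ c, ((ι c : auxO D) : D) = algebraMap F D c) (hσ : Function.Surjective σ)
    (hρ0 : ∀ x : auxO D, ρ x = 0 ↔ ‖(x : D)‖ < 1)
    (hc : ∀ c, ρ (ι c) = algebraMap k l (σ c)) {f : ℕ} (v : Fin f → auxO D)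
    (hv : Submodule.span k (Set.range (fun i => ρ (v i))) = ⊤)
    {P : D} {w : F} (hP0 : 0 < ‖P‖) (hP1 : ‖P‖ < 1) (hPm : ∀ x : D, ‖x‖ < 1 → ‖x‖ ≤ ‖P‖)
    {e : ℕ} (he1 : 1 ≤ e) (he : ‖w‖ = ‖P‖ ^ e) : Module.finrank F D ≤ f * e := by
  let b : Fin f × Fin e → D := fun q => (v q.1 : D) * P ^ (q.2 : ℕ)
  let V : Submodule F D := Submodule.span F (Set.range b)
  have hw0 : 0 < ‖w‖ := by rw [he]; positivity
  have hw1 : ‖w‖ < 1 := by rw [he]; exact pow_lt_one₀ hP0.le hP1 (by omega)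
  have hPne : P ≠ 0 := norm_pos_iff.1 hP0
  have hwne : w ≠ 0 := norm_pos_iff.1 hw0
  have step : ∀ y : D, ‖y‖ ≤ 1 → ∃ c : Fin f → F, ‖y - ∑ i, c i • (v i : D)‖ ≤ ‖P‖ := by
    intro y hy
    have h1 : ρ ⟨y, hy⟩ ∈ Submodule.span k (Set.range (fun i => ρ (v i))) := by rw [hv]; trivial
    rw [Submodule.mem_span_range_iff_exists_fun] at h1
    obtain ⟨c, hc1⟩ := h1
    choose c' hc' using fun i => hσ (c i)
    refine ⟨fun i => (c' i : F), ?_⟩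
    have h2 : ρ (⟨y, hy⟩ - ∑ i, ι (c' i) * v i) = 0 := by
      rw [map_sub, ← hc1, map_sum, sub_eq_zero]
      refine Finset.sum_congr rfl fun i _ => ?_
      rw [map_mul, hc, hc', Algebra.smul_def]
    rw [hρ0] at h2
    apply hPm
    convert h2 using 2
    push_cast
    congr 1
    refine Finset.sum_congr rfl fun i _ => ?_
    rw [hι, Algebra.smul_def]
  have approx : ∀ x : D, ‖x‖ ≤ 1 → ∀ N : ℕ, ∃ u ∈ V, ‖x - u‖ ≤ ‖P‖ ^ N := by
    intro x hx N
    induction N with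
    | zero => exact ⟨0, V.zero_mem, by simpa using hx⟩
    | succ N ih =>
      obtain ⟨u, hu, hxu⟩ := ih
      set a := N / e
      set j := N % e
      have hN : N = e * a + j := (Nat.div_add_mod N e).symm
      have hj : j < e := Nat.mod_lt _ he1
      have hy : ‖(w ^ a)⁻¹ • ((x - u) * (P ^ j)⁻¹)‖ ≤ 1 := by
        rw [norm_smul, norm_mul, norm_inv, norm_inv, norm_pow, norm_pow, he, ← pow_mul]
        rw [hN, pow_add] at hxu
        have hA : 0 < ‖P‖ ^ (e * a) := by positivity
        have hB : 0 < ‖P‖ ^ j := by positivity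
        calc _ ≤ (‖P‖ ^ (e * a))⁻¹ * (‖P‖ ^ (e * a) * ‖P‖ ^ j * (‖P‖ ^ j)⁻¹) := by gcongr
          _ = 1 := by field_simp
      obtain ⟨c, hcy⟩ := step _ hy
      refine ⟨u + ∑ i, (w ^ a * c i) • b (i, ⟨j, hj⟩), V.add_mem hu (V.sum_mem fun i _ =>
        V.smul_mem _ (Submodule.subset_span ⟨_, rfl⟩)), ?_⟩
      have h3 : x - (u + ∑ i, (w ^ a * c i) • b (i, ⟨j, hj⟩)) =
          w ^ a • (((w ^ a)⁻¹ • ((x - u) * (P ^ j)⁻¹) - ∑ i, c i • (v i : D)) * P ^ j) := by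
        rw [sub_mul, smul_sub, smul_mul_assoc, smul_smul, mul_inv_cancel₀ (pow_ne_zero _ hwne), one_smul,
          mul_assoc, inv_mul_cancel₀ (pow_ne_zero _ hPne), mul_one, ← sub_sub, Finset.sum_mul, Finset.smul_sum]
        congr 1
        refine Finset.sum_congr rfl fun i _ => ?_
        simp only [b]
        rw [smul_mul_assoc, smul_smul]
      rw [h3, norm_smul, norm_mul, norm_pow, norm_pow, he, ← pow_mul]
      calc _ ≤ ‖P‖ ^ (e * a) * (‖P‖ * ‖P‖ ^ j) := by gcongr
        _ = ‖P‖ ^ (N + 1) := by rw [hN]; ring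
  have hcl : IsClosed (V : Set D) := Submodule.closed_of_finiteDimensional V
  have hV1 : ∀ x : D, ‖x‖ ≤ 1 → x ∈ V := by
    intro x hx
    have : x ∈ closure (V : Set D) := by
      rw [Metric.mem_closure_iff]
      intro ε hε
      obtain ⟨N, hN⟩ := exists_pow_lt_of_lt_one hε hP1
      obtain ⟨u, hu, hxu⟩ := approx x hx N
      exact ⟨u, hu, by rw [dist_eq_norm]; exact hxu.trans_lt hN⟩
    rwa [hcl.closure_eq] at this
  have hV : V = ⊤ := by
    rw [eq_top_iff]
    intro x _
    obtain ⟨N, hN⟩ := exists_pow_lt_of_lt_one (show 0 < (‖x‖ + 1)⁻¹ by positivity) hw1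
    have h1 : w ^ N • x ∈ V := by
      apply hV1
      rw [norm_smul, norm_pow]
      calc _ ≤ (‖x‖ + 1)⁻¹ * (‖x‖ + 1) := by gcongr; linarith
        _ = 1 := inv_mul_cancel₀ (by positivity)
    have h2 := V.smul_mem (w ^ N)⁻¹ h1
    rwa [smul_smul, inv_mul_cancel₀ (pow_ne_zero _ hwne), one_smul] at h2
  have h4 := finrank_range_le_card (R := F) b
  rw [Set.finrank] at h4
  change Module.finrank F V ≤ _ at h4
  rw [hV, finrank_top] at h4
  simpa using h4
open Polynomial in
theorem aux_gen (k l : Type*) [Field k] [Field l] [Finite k] [Finite l] [Algebra k l] :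
    ∃ ζ : l, ζ ≠ 0 ∧ (minpoly k ζ).natDegree = Module.finrank k l ∧
      Submodule.span k (Set.range (fun i : Fin (minpoly k ζ).natDegree => ζ ^ (i : ℕ))) = ⊤ ∧
      ∀ z : k, z ≠ 0 → ∃ i : ℕ, ((-1) ^ (minpoly k ζ).natDegree * (minpoly k ζ).coeff 0) ^ i = z := by
  obtain ⟨z, hz⟩ := IsCyclic.exists_generator (α := lˣ)
  have hz' : ∀ y : l, y ≠ 0 → ∃ i : ℕ, (z : l) ^ i = y := by
    intro y hy
    have h1 := hz (Units.mk0 y hy)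
    rw [← mem_powers_iff_mem_zpowers] at h1
    obtain ⟨i, hi⟩ := h1
    refine ⟨i, ?_⟩
    have := congrArg Units.val hi
    simpa using this
  have : FiniteDimensional k l := Module.Finite.of_finite
  have hintg : IsIntegral k (z : l) := Algebra.IsIntegral.isIntegral _
  have htop : Algebra.adjoin k {(z : l)} = ⊤ := by
    rw [eq_top_iff]
    intro y _
    rcases eq_or_ne y 0 with rfl | hy
    · exact Subalgebra.zero_mem _
    · obtain ⟨i, rfl⟩ := hz' y hy
      exact Subalgebra.pow_mem _ (Algebra.self_mem_adjoin_singleton k _) i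
  have hdeg : (minpoly k (z : l)).natDegree = Module.finrank k l := by
    have := (PowerBasis.ofAdjoinEqTop hintg htop).finrank
    rw [PowerBasis.ofAdjoinEqTop_dim] at this
    exact this.symm
  refine ⟨z, z.ne_zero, hdeg, ?_, ?_⟩
  · exact (linearIndependent_pow (K := k) (z : l)).span_eq_top_of_card_eq_finrank' (by simp [hdeg])
  · intro y hy
    have hg := Algebra.PowerBasis.norm_gen_eq_coeff_zero_minpoly (PowerBasis.ofAdjoinEqTop hintg htop)
    rw [PowerBasis.ofAdjoinEqTop_dim, PowerBasis.ofAdjoinEqTop_gen] at hg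
    rw [← hg]
    obtain ⟨t, rfl⟩ := FiniteField.norm_surjective k l y
    have ht : t ≠ 0 := by
      rintro rfl
      exact hy (Algebra.norm_zero ..)
    obtain ⟨i, rfl⟩ := hz' t ht
    exact ⟨i, by rw [map_pow]⟩

open Polynomial in
theorem aux_unit {F D k l : Type*} [NontriviallyNormedField F] [IsUltrametricDist F]
    [NormedDivisionRing D] [NormedAlgebra F D] [IsUltrametricDist D] [ProperSpace D] [FiniteDimensional F D]
    [Field k] [Field l] [Finite k] [Finite l] [Algebra k l]
    (ι : auxO F →+* auxO D) (σ : auxO F →+* k) (ρ : auxO D →+* l)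
    (hι : ∀ c, ((ι c : auxO D) : D) = algebraMap F D c) (hσ : Function.Surjective σ)
    (hρ : Function.Surjective ρ)
    (hρ0 : ∀ x : auxO D, ρ x = 0 ↔ ‖(x : D)‖ < 1)
    (hc : ∀ c, ρ (ι c) = algebraMap k l (σ c)) (ζ : l) {n : ℕ} (hn : 1 ≤ n)
    (hdeg : (minpoly k ζ).natDegree = n) (u : auxO F) (hu : σ u = (-1) ^ n * (minpoly k ζ).coeff 0) :
    ∃ β : D, LinearIndependent F (fun i : Fin n => β ^ (i : ℕ)) ∧
      ((minpoly F β).natDegree = n → (-1) ^ n * (minpoly F β).coeff 0 = u) := by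
  obtain ⟨α, hα⟩ := hρ ζ
  have : FiniteDimensional k l := Module.Finite.of_finite
  have hintg : IsIntegral k ζ := Algebra.IsIntegral.isIntegral _
  have hlift : minpoly k ζ ∈ lifts σ := by
    rw [lifts_iff_coeff_lifts]
    exact fun i => hσ _
  obtain ⟨q, hq1, hq2, hq3⟩ := lifts_and_natDegree_eq_and_monic hlift (minpoly.monic hintg)
  rw [hdeg] at hq2
  have hnt : Nontrivial (auxO F) := inferInstance
  set c : auxO F := (-1) ^ n * u - q.coeff 0 with hcdef
  set r : (auxO F)[X] := q + C c with hr
  have hdlt : (C c).degree < q.degree := by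
    refine degree_C_le.trans_lt ?_
    rw [degree_eq_natDegree hq3.ne_zero, hq2]
    exact_mod_cast hn
  have hrm : r.Monic := hq3.add_of_left hdlt
  have hrd : r.natDegree = n := by
    rw [hr, natDegree_add_C, hq2]
  have hσc : σ c = 0 := by
    have : σ (q.coeff 0) = (minpoly k ζ).coeff 0 := by rw [← hq1, coeff_map]
    rw [hcdef, map_sub, map_mul, map_pow, map_neg, map_one, hu, this, ← mul_assoc, ← mul_pow]
    simp
  have hrσ : r.map σ = minpoly k ζ := by
    rw [hr, Polynomial.map_add, hq1, map_C, hσc, C_0, add_zero]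
  set p : F[X] := r.map (auxO F).subtype with hp
  have hpm : p.Monic := hrm.map _
  have hpd : p.natDegree = n := by rw [hp, hrm.natDegree_map, hrd]
  have hA : ∀ (s : (auxO F)[X]) (b : auxO D), ((eval₂ ι b s : auxO D) : D) =
      aeval (b : D) (s.map (auxO F).subtype) := by
    intro s b
    rw [aeval_def, eval₂_map]
    have := hom_eval₂ s ι (auxO D).subtype b
    rw [Subring.subtype_apply] at this
    rw [this]
    congr 1
    ext x
    exact hι x
  have hB : ∀ (s : (auxO F)[X]) (b : auxO D), ρ (eval₂ ι b s) = aeval (ρ b) (s.map σ) := by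
    intro s b
    rw [hom_eval₂, aeval_def, eval₂_map]
    congr 1
    ext x
    exact hc x
  obtain ⟨β, hβα, hβ⟩ := aux_hensel p (fun i => by
      rw [hp, coeff_map]; exact (r.coeff i).2) (α : D) α.2
    (by rw [← hA, ← hρ0, hB, hrσ, hα, minpoly.aeval])
    (by
      rw [derivative_map, ← hA]
      apply le_antisymm (eval₂ ι α (derivative r)).2
      rw [← not_lt, ← hρ0, hB, ← derivative_map, hrσ, hα]
      have hsep : (minpoly k ζ).Separable := Algebra.IsSeparable.isSeparable k ζ
      exact hsep.aeval_derivative_ne_zero (minpoly.aeval k ζ))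
  have hβ1 : ‖β‖ ≤ 1 := by
    have := IsUltrametricDist.norm_add_le_max (β - α) (α : D)
    rw [sub_add_cancel] at this
    exact this.trans (max_le hβα.le α.2)
  have hβζ : ρ ⟨β, hβ1⟩ = ζ := by
    rw [← hα, ← sub_eq_zero, ← map_sub, hρ0]
    exact hβα
  refine ⟨β, ?_, ?_⟩
  · have h1 := aux_LI_res ι σ ρ hι hc (fun i : Fin n => (⟨β, hβ1⟩ : auxO D) ^ (i : ℕ)) (by
      simp only [map_pow, hβζ]
      have := linearIndependent_pow (K := k) ζ
      rw [hdeg] at this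
      exact this)
    exact h1
  · intro hd
    have h2 : p = minpoly F β := by
      refine eq_of_monic_of_dvd_of_natDegree_le (minpoly.monic (Algebra.IsIntegral.isIntegral β)) hpm
        (minpoly.dvd F β hβ) (by rw [hpd, hd])
    rw [← h2, hp, coeff_map, hr, coeff_add, coeff_C_zero, hcdef, add_sub_cancel]
    simp [← mul_assoc, ← mul_pow]
theorem aux_final {F D E : Type*} [NontriviallyNormedField F] [IsUltrametricDist F] [ProperSpace F]
    [CharZero F] [NormedDivisionRing D] [NormedAlgebra F D] [IsUltrametricDist D] [ProperSpace D]
    [FiniteDimensional F D] [Field E] [Algebra F E]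
    {n : ℕ} (hn : 1 ≤ n) (hdim : Module.finrank F D = n * n)
    (φ : D →ₐ[F] Matrix (Fin n) (Fin n) E)
    (hφ : ∀ (m : ℕ) (v : Fin m → D), LinearIndependent F v → LinearIndependent E (φ ∘ v))
    (a : F) (ha : a ≠ 0) :
    ∃ x : D, LinearIndependent F (fun i : Fin n => x ^ (i : ℕ)) ∧
      (φ x).det = algebraMap F E a := by
  obtain ⟨y, hy0, hy1⟩ := NormedField.exists_norm_lt_one F
  obtain ⟨w, hw0, hw1, hwm, hw⟩ := aux_unif F ⟨y, norm_pos_iff.1 hy0, hy1⟩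
  have hwD : ‖algebraMap F D w‖ = ‖w‖ := norm_algebraMap' D w
  have hwne : algebraMap F D w ≠ 0 := by rw [← norm_pos_iff, hwD]; exact hw0
  obtain ⟨P, hP0, hP1, hPm, hPz⟩ := aux_unif D ⟨algebraMap F D w, hwne, by rw [hwD]; exact hw1⟩
  obtain ⟨e', he'⟩ := hPz _ hwne
  rw [hwD] at he'
  have he'pos : 0 < e' := by
    by_contra hcon
    push Not at hcon
    have := one_le_zpow_of_nonpos₀ hP0 hP1.le hcon
    rw [← he'] at this
    exact absurd hw1 (not_lt.2 this)
  obtain ⟨e, rfl⟩ := Int.eq_ofNat_of_zero_le he'pos.le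
  rw [zpow_natCast] at he'
  have he1 : 1 ≤ e := by exact_mod_cast he'pos
  have hen : e ≤ n := aux_deg_le φ hφ (aux_LI_P hP0 hP1 hw he')
  obtain ⟨k, _, _, l, _, _, _, ι, σ, ρ, hι, hσ, hρ, hσ0, hρ0, hc⟩ := aux_residue2 F D
  obtain ⟨ζ, hζ0, hζ1, hζs, hζg⟩ := aux_gen k l
  obtain ⟨α, hα⟩ := hρ ζ
  have hfn : (minpoly k ζ).natDegree ≤ n := by
    have h1 := aux_LI_res ι σ ρ hι hc (fun i : Fin (minpoly k ζ).natDegree => α ^ (i : ℕ)) (by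
      simp only [map_pow, hα]
      exact linearIndependent_pow (K := k) ζ)
    exact aux_deg_le φ hφ h1
  have hnn := aux_span ι σ ρ hι hσ hρ0 hc (fun i : Fin (minpoly k ζ).natDegree => α ^ (i : ℕ)) (by
      simp only [map_pow, hα]
      exact hζs) hP0 hP1 hPm he1 he'
  rw [hdim] at hnn
  have hf : (minpoly k ζ).natDegree = n := by
    apply le_antisymm hfn
    by_contra hlt
    push Not at hlt
    have : (minpoly k ζ).natDegree * e < n * n := by nlinarith
    omega
  have he : e = n := by
    apply le_antisymm hen
    by_contra hlt
    push Not at hlt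
    rw [hf] at hnn
    have : n * e < n * n := by nlinarith
    omega
  subst he
  rw [hf] at hζg
  have hPreg := aux_LI_P hP0 hP1 hw he'
  obtain ⟨hPd, hPdet⟩ := aux_reg φ hφ hPreg
  have hPc := aux_coeff0 hP0 hP1 hw he1 he' hPd
  set b : F := (-1) ^ e * (minpoly F P).coeff 0 with hb
  have hbn : ‖b‖ = ‖w‖ := by rw [hb, norm_mul, norm_pow, norm_neg, norm_one, one_pow, one_mul, hPc]
  have hb0 : b ≠ 0 := by rw [← norm_pos_iff, hbn]; exact hw0
  have hu : ∀ u : auxO F, σ u = (-1) ^ e * (minpoly k ζ).coeff 0 → ∃ β : D,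
      (φ β).det = algebraMap F E u := by
    intro u hu
    obtain ⟨β, h1, h2⟩ := aux_unit ι σ ρ hι hσ hρ hρ0 hc ζ hn hf u hu
    obtain ⟨h3, h4⟩ := aux_reg φ hφ h1
    exact ⟨β, by rw [h4, h2 h3]⟩
  obtain ⟨m, hm⟩ := hw a ha
  have hu1 : ‖a / b ^ m‖ = 1 := by
    rw [norm_div, norm_zpow, hbn, hm, div_self (zpow_ne_zero _ hw0.ne')]
  set g : k := (-1) ^ e * (minpoly k ζ).coeff 0 with hg
  have hg0 : g ≠ 0 := by
    intro h0
    rw [hg] at h0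
    have h1 : (minpoly k ζ).coeff 0 = 0 := by
      rcases mul_eq_zero.1 h0 with h | h
      · exact absurd h (pow_ne_zero _ (neg_ne_zero.2 one_ne_zero))
      · exact h
    have : FiniteDimensional k l := Module.Finite.of_finite
    exact hζ0 ((minpoly.coeff_zero_eq_zero (Algebra.IsIntegral.isIntegral ζ)).1 h1)
  obtain ⟨u0, hu0⟩ := hσ g
  let u : auxO F := ⟨a / b ^ m, hu1.le⟩
  have hσu : σ u ≠ 0 := by
    rw [Ne, hσ0]
    exact not_lt.2 hu1.ge
  obtain ⟨i, hi⟩ := hζg ((σ u)⁻¹ * g) (mul_ne_zero (inv_ne_zero hσu) hg0)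
  obtain ⟨β0, hβ0⟩ := hu u0 hu0
  obtain ⟨β1, hβ1⟩ := hu (u * u0 ^ i) (by
    rw [map_mul, map_pow, hu0, hi, mul_inv_cancel_left₀ hσu])
  have hu00 : (u0 : F) ≠ 0 := by
    intro h
    apply hg0
    rw [← hu0, hσ0, h, norm_zero]
    exact one_pos
  have : Nonempty (Fin e) := ⟨⟨0, hn⟩⟩
  let δ : D →*₀ E :=
    { toFun := fun x => (φ x).det
      map_zero' := by rw [map_zero, Matrix.det_zero]
      map_one' := by rw [map_one, Matrix.det_one]
      map_mul' := fun x y => by rw [map_mul, Matrix.det_mul] }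
  refine aux_density hn φ hφ hPreg (h := β1 * (β0 ^ i)⁻¹ * P ^ m) ha ?_
  change δ (β1 * (β0 ^ i)⁻¹ * P ^ m) = _
  have e1 : δ β1 = algebraMap F E ((u * u0 ^ i : auxO F) : F) := hβ1
  have e0 : δ β0 = algebraMap F E u0 := hβ0
  have eP : δ P = algebraMap F E b := hPdet
  rw [map_mul, map_mul, map_inv₀, map_pow, map_zpow₀, e1, e0, eP, ← map_pow, ← map_inv₀, ← map_zpow₀,
    ← map_mul, ← map_mul]
  congr 1
  change a / b ^ m * (u0 : F) ^ i * ((u0 : F) ^ i)⁻¹ * b ^ m = a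
  rw [mul_inv_cancel_right₀ (pow_ne_zero _ hu00), div_mul_cancel₀ _ (zpow_ne_zero _ hb0)]
theorem aux_field {F D : Type*} [NontriviallyNormedField F] [IsUltrametricDist F] [ProperSpace F]
    [CharZero F] [iD : DivisionRing D] [iA : Algebra F D] (n : ℕ) (hn : 1 ≤ n)
    (hdim : Module.finrank F D = n * n)
    (hcentral : Subalgebra.center F D = ⊥)
    (a : F) (ha : a ≠ 0) :
    ∃ h : D, h ≠ 0 ∧ (minpoly F h).Monic ∧ (minpoly F h).natDegree = n ∧
      (minpoly F h).Separable ∧ Irreducible (minpoly F h) ∧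
      (-1 : F) ^ n * (minpoly F h).coeff 0 = a := by
  have hpos : 0 < Module.finrank F D := by rw [hdim]; positivity
  have hfd : FiniteDimensional F D := Module.finite_of_finrank_pos hpos
  obtain ⟨φ, hφ⟩ := aux_split (AlgebraicClosure F) n hn hdim hcentral
  have key : ∃ x : D, LinearIndependent F (fun i : Fin n => x ^ (i : ℕ)) ∧
      (φ x).det = algebraMap F (AlgebraicClosure F) a := by
    obtain ⟨N, hN0, hNz, hNe, hNm, hNu, hNa⟩ := aux_norm hn φ
    have hN1 : N (-1) = 1 := by
      have := hNa (-1)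
      simpa using this
    have hNneg : ∀ x, N (-x) = N x := by
      intro x
      rw [← neg_one_mul, hNm, hN1, one_mul]
    letI iN : NormedDivisionRing D :=
      { iD with
        norm := N
        dist := fun x y => N (-x + y)
        dist_self := fun x => by simp [hNz]
        dist_comm := fun x y => by
          rw [← hNneg]; congr 1; abel
        dist_triangle := fun x y z => by
          have h1 : -x + z = (-x + y) + (-y + z) := by abel
          calc N (-x + z) ≤ max (N (-x + y)) (N (-y + z)) := by rw [h1]; exact hNu _ _
            _ ≤ _ := max_le_add_of_nonneg (hN0 _) (hN0 _)
        eq_of_dist_eq_zero := fun {x y} h => by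
          have := hNe _ h
          exact (neg_add_eq_zero.1 this)
        dist_eq := fun x y => rfl
        norm_mul := hNm }
    letI iNA : NormedAlgebra F D :=
      { iA with
        norm_smul_le := fun c x => by
          rw [Algebra.smul_def]
          change N _ ≤ _ * N _
          rw [hNm, hNa] }
    haveI : IsUltrametricDist D := IsUltrametricDist.isUltrametricDist_of_isNonarchimedean_norm hNu
    haveI : ProperSpace D := FiniteDimensional.proper F D
    exact aux_final hn hdim φ hφ a ha
  obtain ⟨x, hx, hxd⟩ := key
  obtain ⟨h1, h2⟩ := aux_reg φ hφ hx
  have hintg : IsIntegral F x := Algebra.IsIntegral.isIntegral x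
  have h3 : (-1 : F) ^ n * (minpoly F x).coeff 0 = a :=
    (algebraMap F (AlgebraicClosure F)).injective (h2.symm.trans hxd)
  have hirr := minpoly.irreducible hintg
  refine ⟨x, ?_, minpoly.monic hintg, h1, hirr.separable, hirr, h3⟩
  rintro rfl
  rw [minpoly.zero] at h3
  apply ha
  rw [← h3]
  simp


/-- For `F/ℚ_p` finite and `D` the central division algebra of
degree `n` over `F`, the reduced norm restricts to a surjection from the set of
regular elliptic elements of `D^×` onto `F^×`: every `a ∈ F^×` is of the form
`(-1)^n · f(0)` where `f` is the reduced characteristic polynomial (a monic,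
separable, irreducible polynomial of degree `n` which is a power of the minimal
polynomial) of some `h ∈ D^×`. -/
theorem reduced_norm_surjective_on_regular_elliptic
    (p : ℕ) [Fact p.Prime] (F : Type*) [Field F] [Algebra ℚ_[p] F]
    [FiniteDimensional ℚ_[p] F]
    (D : Type*) [DivisionRing D] [Algebra F D] (n : ℕ) (hn : 1 ≤ n)
    (hdim : Module.finrank F D = n * n)
    (hcentral : Subalgebra.center F D = ⊥)
    (a : F) (ha : a ≠ 0) :
    ∃ (h : D) (f : Polynomial F) (k : ℕ), h ≠ 0 ∧
      f = minpoly F h ^ k ∧ f.Monic ∧ f.natDegree = n ∧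
      f.Separable ∧ Irreducible f ∧ (-1 : F) ^ n * f.coeff 0 = a := by
  letI i1 : NontriviallyNormedField F := spectralNorm.nontriviallyNormedField ℚ_[p] F
  letI i2 : NormedAlgebra ℚ_[p] F := spectralNorm.normedAlgebra ℚ_[p] F
  haveI : IsUltrametricDist F := IsUltrametricDist.isUltrametricDist_of_isNonarchimedean_norm
    (isNonarchimedean_spectralNorm (K := ℚ_[p]) (L := F))
  haveI : ProperSpace F := FiniteDimensional.proper ℚ_[p] F
  haveI : CharZero F := charZero_of_injective_algebraMap (algebraMap ℚ_[p] F).injective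
  obtain ⟨h, h0, h1, h2, h3, h4, h5⟩ := aux_field (F := F) (D := D) n hn hdim hcentral a ha
  exact ⟨h, minpoly F h, 1, h0, (pow_one _).symm, h1, h2, h3, h4, h5⟩
end

section
/- For every n ≥ 1 and every a ∈ F^×, where F is a finite extension of Q_p, there exists a monic irreducible polynomial over F of degree n with constant term a. -/
section
open Polynomial

theorem dvr_ff_exists (k : Type*) [Field k] [Finite k] (d : ℕ) (hd : 1 ≤ d) (c : k) (hc : c ≠ 0) :
    ∃ f : k[X], f.Monic ∧ Irreducible f ∧ f.natDegree = d ∧ f.coeff 0 = c := by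
  classical
  obtain ⟨p, hp⟩ := CharP.exists k
  have : Fact p.Prime := ⟨CharP.char_is_prime k p⟩
  have : NeZero d := ⟨by omega⟩
  let E := FiniteField.Extension k p d
  have hfr : Module.finrank k E = d := FiniteField.finrank_extension k p d
  have hcard : Nat.card E = Nat.card k ^ d := FiniteField.natCard_extension k p d
  have hq : 2 ≤ Nat.card k := Finite.one_lt_card
  set q := Nat.card k with hqdef
  obtain ⟨z, hz⟩ := IsCyclic.exists_generator (α := Eˣ)
  have hord : orderOf z = q ^ d - 1 := by
    rw [orderOf_eq_card_of_forall_mem_zpowers hz, Nat.card_units, hcard]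
  -- every z^i with 1 ≤ i ≤ q-1 generates
  have gen : ∀ i : ℕ, 1 ≤ i → i ≤ q - 1 → (minpoly k ((z ^ i : Eˣ) : E)).natDegree = d := by
    intro i h1 h2
    set x : E := ((z ^ i : Eˣ) : E) with hx
    have hint : IsIntegral k x := IsIntegral.of_finite k x
    set r := (minpoly k x).natDegree with hr
    have hrd : r ≤ d := hfr ▸ minpoly.natDegree_le x
    have hr1 : 1 ≤ r := minpoly.natDegree_pos hint
    by_contra hne
    have hlt : r + 1 ≤ d := by omega
    let y : IntermediateField.adjoin k {x} := IntermediateField.AdjoinSimple.gen k x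
    have hcy : Nat.card (IntermediateField.adjoin k {x}) = q ^ r := by
      rw [Module.natCard_eq_pow_finrank (K := k), IntermediateField.adjoin.finrank hint]
    have hy0 : y ≠ 0 := by
      intro h
      have : x = 0 := by
        have := congrArg (algebraMap _ E) h
        simpa [y] using this
      exact (z ^ i).ne_zero this
    have hypow : y ^ (q ^ r - 1) = 1 := by
      have : Fintype (IntermediateField.adjoin k {x}) := Fintype.ofFinite _
      have h := FiniteField.pow_card_sub_one_eq_one y hy0
      rwa [← Nat.card_eq_fintype_card, hcy] at h
    have hxpow : x ^ (q ^ r - 1) = 1 := by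
      have := congrArg (algebraMap _ E) hypow
      simpa [y] using this
    have hzpow : z ^ (i * (q ^ r - 1)) = 1 := by
      rw [pow_mul]; ext; simpa [hx] using hxpow
    have hdvd := orderOf_dvd_of_pow_eq_one hzpow
    rw [hord] at hdvd
    have hqr : q ≤ q ^ r := Nat.le_self_pow (by omega) q
    have hpos : 0 < i * (q ^ r - 1) := Nat.mul_pos (by omega) (by omega)
    have hle := Nat.le_of_dvd hpos hdvd
    have h3 : q ^ (r + 1) ≤ q ^ d := Nat.pow_le_pow_right (by omega) hlt
    have h4 : i * (q ^ r - 1) ≤ (q - 1) * (q ^ r - 1) := Nat.mul_le_mul_right _ h2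
    obtain ⟨s, hs⟩ : ∃ s, q = s + 1 := ⟨q - 1, by omega⟩
    obtain ⟨t, ht⟩ : ∃ t, q ^ r = t + 1 := ⟨q ^ r - 1, by omega⟩
    rw [pow_succ, ht, hs] at h3
    rw [ht, hs] at h4
    simp only [Nat.add_sub_cancel] at h4
    have h5 : q ^ d - 1 ≤ s * t := by
      rw [ht] at hle
      exact hle.trans h4
    have h6 : s * t + s + t + 1 ≤ q ^ d := by rw [hs]; linarith
    omega
  -- norm
  have hc' : (-1) ^ d * c ≠ 0 := mul_ne_zero (pow_ne_zero _ (by simp)) hc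
  obtain ⟨y, hy⟩ := FiniteField.unitsMap_norm_surjective k E (Units.mk0 _ hc')
  obtain ⟨j, hj⟩ := mem_powers_iff_mem_zpowers.2 (hz y)
  have hj : z ^ j = y := hj
  obtain ⟨i, h1, h2, hi⟩ : ∃ i, 1 ≤ i ∧ i ≤ q - 1 ∧ (Units.map (Algebra.norm k (S := E))) (z ^ i) = Units.mk0 _ hc' := by
    have hcu : ∀ w : kˣ, w ^ (q - 1) = 1 := by
      intro w
      have : Nat.card kˣ = q - 1 := Nat.card_units k
      rw [← this]; exact pow_card_eq_one'
    have key : ∀ i i' : ℕ, i ≡ i' [MOD (q-1)] → (Units.map (Algebra.norm k (S := E))) (z ^ i) = (Units.map (Algebra.norm k (S := E))) (z ^ i') := by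
      intro i i' h
      rw [map_pow, map_pow]
      apply pow_eq_pow_iff_modEq.2
      exact h.of_dvd (orderOf_dvd_of_pow_eq_one (hcu _))
    by_cases h0 : j % (q - 1) = 0
    · refine ⟨q - 1, by omega, le_rfl, ?_⟩
      rw [← hy, ← hj]
      apply key
      rw [Nat.ModEq, h0]; simp
    · refine ⟨j % (q - 1), by omega, (Nat.mod_lt _ (by omega)).le, ?_⟩
      rw [← hy, ← hj]
      apply key
      exact Nat.mod_modEq _ _
  set x : E := ((z ^ i : Eˣ) : E) with hx
  have hint : IsIntegral k x := IsIntegral.of_finite k x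
  have hdeg := gen i h1 h2
  refine ⟨minpoly k x, minpoly.monic hint, minpoly.irreducible hint, hdeg, ?_⟩
  have hn : Algebra.norm k x = (-1) ^ d * c := by
    have := congrArg Units.val hi
    exact this
  have htop : IntermediateField.adjoin k {x} = ⊤ :=
    (Field.primitive_element_iff_minpoly_natDegree_eq k x).2 (by rw [hdeg, hfr])
  have hn2 := Algebra.norm_eq_norm_adjoin k x
  have h1' : Module.finrank (IntermediateField.adjoin k {x}) E = 1 := by
    rw [htop]; exact IntermediateField.finrank_top
  rw [h1', pow_one] at hn2
  have h3 := Algebra.PowerBasis.norm_gen_eq_coeff_zero_minpoly (IntermediateField.adjoin.powerBasis hint)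
  rw [IntermediateField.adjoin.powerBasis_gen, ← hn2, hn, IntermediateField.minpoly_gen,
    IntermediateField.adjoin.powerBasis_dim, hdeg] at h3
  exact (mul_left_cancel₀ (pow_ne_zero _ (by simp)) h3).symm

theorem exists_lift (R : Type*) [CommRing R] [IsDomain R] [IsDiscreteValuationRing R]
    [Finite (IsLocalRing.ResidueField R)] (d : ℕ) (hd : 1 ≤ d) (u : Rˣ) :
    ∃ h : R[X], h.Monic ∧ Irreducible (h.map (IsLocalRing.residue R)) ∧ h.natDegree = d ∧
      h.coeff 0 = u := by
  obtain ⟨g, gm, gi, gd, g0⟩ := dvr_ff_exists (IsLocalRing.ResidueField R) d hd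
    (IsLocalRing.residue R u) (u.isUnit.map (IsLocalRing.residue R)).ne_zero
  obtain ⟨h, h1, h2, h3⟩ := lifts_and_natDegree_eq_and_monic
    ((mem_lifts _).2 (map_surjective _ IsLocalRing.residue_surjective g)) gm
  have hdeg : (C ((u : R) - h.coeff 0)).degree < h.degree :=
    degree_C_le.trans_lt (natDegree_pos_iff_degree_pos.1 (by omega))
  refine ⟨h + C (u - h.coeff 0), h3.add_of_left hdeg, ?_, ?_, by simp⟩
  · have : IsLocalRing.residue R (u - h.coeff 0) = 0 := by
      rw [map_sub, ← g0, ← h1, coeff_map, sub_self]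
    rw [Polynomial.map_add, map_C, this, C_0, add_zero, h1]
    exact gi
  · rw [natDegree_add_eq_left_of_degree_lt hdeg, h2, gd]

theorem A_domain {R : Type*} [CommRing R] [IsDomain R] [IsDiscreteValuationRing R]
    {h : R[X]} (hm : h.Monic) (hi : Irreducible (h.map (IsLocalRing.residue R))) : IsDomain (AdjoinRoot h) :=
  AdjoinRoot.isDomain_of_prime (hm.irreducible_of_irreducible_map (IsLocalRing.residue R) h hi).prime

theorem A_max {R : Type*} [CommRing R] [IsDomain R] [IsDiscreteValuationRing R]
    {h : R[X]} (hi : Irreducible (h.map (IsLocalRing.residue R))) {π : R} (hπ : Irreducible π) :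
    (Ideal.span {algebraMap R (AdjoinRoot h) π}).IsMaximal := by
  have hspan : Ideal.span {algebraMap R (AdjoinRoot h) π} =
      (IsLocalRing.maximalIdeal R).map (AdjoinRoot.of h) := by
    rw [hπ.maximalIdeal_eq, Ideal.map_span, Set.image_singleton, AdjoinRoot.algebraMap_eq]
  rw [hspan]
  have hi' : Irreducible (h.map (Ideal.Quotient.mk (IsLocalRing.maximalIdeal R))) := hi
  let _ : Field (R ⧸ IsLocalRing.maximalIdeal R) := Ideal.Quotient.field _
  have : (Ideal.span {h.map (Ideal.Quotient.mk (IsLocalRing.maximalIdeal R))}).IsMaximal :=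
    PrincipalIdealRing.isMaximal_of_irreducible hi'
  have hf := Ideal.Quotient.field (Ideal.span {h.map (Ideal.Quotient.mk (IsLocalRing.maximalIdeal R))})
  apply Ideal.Quotient.maximal_of_isField
  exact (AdjoinRoot.quotEquivQuotMap h (IsLocalRing.maximalIdeal R)).toMulEquiv.isField
    ((Ideal.Quotient.maximal_ideal_iff_isField_quotient _).1 this)

theorem A_intclosed {R : Type*} [CommRing R] [IsDomain R] [IsDiscreteValuationRing R]
    {h : R[X]} (hm : h.Monic) (hi : Irreducible (h.map (IsLocalRing.residue R))) : IsIntegrallyClosed (AdjoinRoot h) := by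
  have := A_domain hm hi
  obtain ⟨π, hπ⟩ := IsDiscreteValuationRing.exists_irreducible R
  have hmax := A_max hi hπ
  have := hm.finite_adjoinRoot
  have hloc : IsLocalRing (AdjoinRoot h) := by
    apply IsLocalRing.of_unique_max_ideal
    refine ⟨_, hmax, fun M hM => ?_⟩
    have hc : (M.comap (algebraMap R (AdjoinRoot h))).IsMaximal :=
      Ideal.isMaximal_comap_of_isIntegral_of_isMaximal M
    have hc2 := IsLocalRing.eq_maximalIdeal hc
    refine (hmax.eq_of_le hM.ne_top ?_).symm
    rw [Ideal.span_singleton_le_iff_mem, ← Ideal.mem_comap, hc2, hπ.maximalIdeal_eq]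
    exact Ideal.mem_span_singleton_self _
  have hpr : (IsLocalRing.maximalIdeal (AdjoinRoot h)).IsPrincipal := by
    rw [← IsLocalRing.eq_maximalIdeal hmax]
    exact ⟨_, rfl⟩
  have h43 := (tfae_of_isNoetherianRing_of_isLocalRing_of_isDomain (AdjoinRoot h)).out 4 3
  exact (h43.1 hpr).1

theorem A_inj {R : Type*} [CommRing R] [IsDomain R] [IsDiscreteValuationRing R]
    {h : R[X]} (hm : h.Monic) (hi : Irreducible (h.map (IsLocalRing.residue R))) : Function.Injective (algebraMap R (AdjoinRoot h)) := by
  have : h.degree ≠ 0 := by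
    have := hi.degree_pos
    rw [hm.degree_map] at this
    exact this.ne'
  exact AdjoinRoot.of.injective_of_degree_ne_zero this

theorem root_unit {R : Type*} [CommRing R] {h : R[X]} (u : Rˣ) (h0 : h.coeff 0 = u) :
    IsUnit (AdjoinRoot.root h) := by
  have := AdjoinRoot.mk_self (f := h)
  have h2 := congrArg (AdjoinRoot.mk h) (divX_mul_X_add h)
  rw [this, map_add, map_mul, AdjoinRoot.mk_X, h0, AdjoinRoot.mk_C] at h2
  have h3 : AdjoinRoot.mk h h.divX * AdjoinRoot.root h = - AdjoinRoot.of h u :=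
    eq_neg_of_add_eq_zero_left h2
  have h4 : IsUnit (- AdjoinRoot.of h u) := (u.isUnit.map (AdjoinRoot.of h)).neg
  rw [← h3] at h4
  exact isUnit_of_mul_isUnit_right h4

theorem eis {A : Type*} [CommRing A] [IsDomain A] [IsIntegrallyClosed A] (K : Type*) [Field K]
    [Algebra A K] [IsFractionRing A K] (π : A) (hπ0 : π ≠ 0) (hπ : (Ideal.span {π}).IsMaximal)
    (v : Aˣ) (e : ℕ) (he : 1 ≤ e) :
    Irreducible (X ^ e - C (algebraMap A K (π * v))) := by
  have hmon : (X ^ e - C (π * (v : A))).Monic := monic_X_pow_sub_C _ (by omega)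
  have hirr : Irreducible (X ^ e - C (π * (v : A))) := by
    refine IsEisensteinAt.irreducible (𝓟 := Ideal.span {π}) ?_ hπ.isPrime hmon.isPrimitive ?_
    · refine hmon.isEisensteinAt_of_mem_of_notMem hπ.ne_top ?_ ?_
      · intro n hn
        rw [natDegree_X_pow_sub_C] at hn
        rw [coeff_sub, coeff_X_pow, if_neg (by omega), zero_sub, coeff_C]
        split_ifs
        · exact neg_mem (Ideal.mul_mem_right _ _ (Ideal.mem_span_singleton_self _))
        · simp
      · rw [coeff_sub, coeff_X_pow, if_neg (by omega), zero_sub, coeff_C_zero, neg_mem_iff,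
          Ideal.span_singleton_pow, Ideal.mem_span_singleton]
        rintro ⟨w, hw⟩
        rw [pow_two, mul_assoc] at hw
        have := mul_left_cancel₀ hπ0 hw
        apply hπ.ne_top
        rw [Ideal.span_singleton_eq_top]
        exact isUnit_of_mul_isUnit_left (this ▸ v.isUnit)
    · rw [natDegree_X_pow_sub_C]; omega
  have := (hmon.irreducible_iff_irreducible_map_fraction_map (K := K)).1 hirr
  simpa using this

theorem core {R : Type*} [CommRing R] [IsDomain R] [IsDiscreteValuationRing R]
    (F : Type*) [Field F] [Algebra R F] [IsFractionRing R F]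
    {h : R[X]} (hm : h.Monic) (hi : Irreducible (h.map (IsLocalRing.residue R)))
    (u : Rˣ) (h0 : h.coeff 0 = u) {π : R} (hπ : Irreducible π) (e : ℕ) (he : 1 ≤ e)
    (k s t : ℤ) (hb : k * s + e * t = 1) :
    Irreducible (expand F e ((h.map (algebraMap R F)).scaleRoots ((algebraMap R F π) ^ k))) := by
  have hdom := A_domain hm hi
  have hint := A_intclosed hm hi
  have hinj := A_inj hm hi
  have hmax := A_max hi hπ
  have hfin := hm.finite_adjoinRoot
  have hfree := hm.free_adjoinRoot
  have hfaith : FaithfulSMul R (AdjoinRoot h) := (faithfulSMul_iff_algebraMap_injective _ _).2 hinj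
  obtain ⟨b, hbroot⟩ := root_unit u h0
  let A := AdjoinRoot h
  let K := FractionRing A
  have hinjK : Function.Injective (algebraMap R K) := by
    rw [IsScalarTower.algebraMap_eq R A K]
    exact (IsFractionRing.injective A K).comp hinj
  let _ : Algebra F K := (IsFractionRing.lift hinjK).toAlgebra
  have : IsScalarTower R F K := IsScalarTower.of_algebraMap_eq
    (fun x => (IsFractionRing.lift_algebraMap hinjK x).symm)
  have hπA : algebraMap R A π ≠ 0 := (map_ne_zero_iff _ hinj).2 hπ.ne_zero
  have hirr := eis K (algebraMap R A π) hπA hmax (b ^ s) e he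
  set q : K[X] := X ^ e - C (algebraMap A K (algebraMap R A π * ((b ^ s : Aˣ) : A))) with hq
  have : Fact (Irreducible q) := ⟨hirr⟩
  have hq0 : q ≠ 0 := hirr.ne_zero
  let L := AdjoinRoot q
  have hKL : Module.finrank K L = e := by
    rw [(AdjoinRoot.powerBasis hq0).finrank, AdjoinRoot.powerBasis_dim, hq, natDegree_X_pow_sub_C]
  have : FiniteDimensional K L := (AdjoinRoot.powerBasis hq0).finite
  have hFK : Module.finrank F K = h.natDegree := by
    rw [IsFractionRing.finrank_eq R F A K, (AdjoinRoot.powerBasis' hm).finrank, AdjoinRoot.powerBasis'_dim]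
  have hd : 0 < h.natDegree := by
    have := hi.natDegree_pos
    rwa [hm.natDegree_map] at this
  have : FiniteDimensional F K := Module.finite_of_finrank_pos (by omega)
  have : FiniteDimensional F L := Module.Finite.trans K L
  have hFL : Module.finrank F L = h.natDegree * e := by
    rw [← Module.finrank_mul_finrank F K L, hFK, hKL]
  let β : L := algebraMap K L (algebraMap A K b)
  let ϖ : L := algebraMap F L (algebraMap R F π)
  let γ : L := AdjoinRoot.root q
  have hβ0 : β ≠ 0 := by
    simp only [β, ne_eq, map_eq_zero]
    exact (map_ne_zero_iff _ (IsFractionRing.injective A K)).2 b.ne_zero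
  have hϖ0 : ϖ ≠ 0 := by
    simp only [ϖ, ne_eq, map_eq_zero]
    exact (map_ne_zero_iff _ (IsFractionRing.injective R F)).2 hπ.ne_zero
  have hbs : algebraMap K L (algebraMap A K ((b ^ s : Aˣ) : A)) = β ^ s := by
    have := map_zpow (Units.map ((algebraMap K L).comp (algebraMap A K) : A →* L)) b s
    have := congrArg Units.val this
    rw [Units.val_zpow_eq_zpow_val] at this
    exact this
  have hϖ : algebraMap K L (algebraMap A K (algebraMap R A π)) = ϖ := by
    simp only [ϖ]
    rw [← IsScalarTower.algebraMap_apply R A K, IsScalarTower.algebraMap_apply F K L,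
      ← IsScalarTower.algebraMap_apply R F K]
  have hγ : γ ^ e = ϖ * β ^ s := by
    have h1 : aeval γ q = 0 := by rw [AdjoinRoot.aeval_eq, AdjoinRoot.mk_self]
    have h2 : aeval γ (X ^ e - C (algebraMap A K (algebraMap R A π * ((b ^ s : Aˣ) : A)))) = 0 := h1
    rw [map_sub, map_pow, aeval_X, aeval_C, sub_eq_zero, map_mul, map_mul, hbs, hϖ] at h2
    exact h2
  have hγ0 : γ ≠ 0 := by
    intro h
    rw [h, zero_pow (by omega)] at hγ
    exact mul_ne_zero hϖ0 (zpow_ne_zero _ hβ0) hγ.symm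
  have hγz : γ ^ (e : ℤ) = ϖ * β ^ s := by rw [zpow_natCast, hγ]
  let α : L := γ ^ k * β ^ t
  have hαe : α ^ e = ϖ ^ k * β := by
    calc α ^ e = (γ ^ (e : ℤ)) ^ k * β ^ (t * e) := by
          simp only [α]
          rw [mul_pow, ← zpow_natCast, ← zpow_natCast, ← zpow_mul, ← zpow_mul, ← zpow_mul, mul_comm k]
      _ = ϖ ^ k * β ^ (k * s + e * t) := by
          rw [hγz, mul_zpow, mul_assoc, ← zpow_mul, ← zpow_add₀ hβ0, mul_comm s, mul_comm t]
      _ = _ := by rw [hb, zpow_one]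
  have hγα : γ = α ^ s * ϖ ^ t := by
    have h1 : γ ^ (k * s) = γ * (γ ^ (e : ℤ)) ^ (- t) := by
      rw [← zpow_mul, ← zpow_one_add₀ hγ0]
      congr 1; linarith
    symm
    calc α ^ s * ϖ ^ t = γ ^ (k * s) * β ^ (t * s) * ϖ ^ t := by
          simp only [α]
          rw [mul_zpow, ← zpow_mul, ← zpow_mul]
      _ = γ * (ϖ ^ (-t) * ϖ ^ t) * (β ^ (s * (-t)) * β ^ (t * s)) := by
          rw [h1, hγz, mul_zpow, ← zpow_mul]; ring
      _ = γ := by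
          rw [← zpow_add₀ hϖ0, ← zpow_add₀ hβ0]
          have : s * -t + t * s = 0 := by ring
          rw [this, neg_add_cancel, zpow_zero, zpow_zero, mul_one, mul_one]
  have hβα : β = α ^ e * (ϖ ^ k)⁻¹ := by
    rw [hαe, mul_comm, inv_mul_cancel_left₀ (zpow_ne_zero _ hϖ0)]
  -- α generates
  let E := IntermediateField.adjoin F {α}
  have hαE : α ∈ E := IntermediateField.mem_adjoin_simple_self F α
  have hϖE : ϖ ∈ E := E.algebraMap_mem _
  have hγE : γ ∈ E := hγα ▸ mul_mem (zpow_mem hαE _) (zpow_mem hϖE _)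
  have hβE : β ∈ E := hβα ▸ mul_mem (pow_mem hαE _) (inv_mem (zpow_mem hϖE _))
  have hAE : ∀ x : A, algebraMap K L (algebraMap A K x) ∈ E := by
    intro x
    obtain ⟨g, rfl⟩ := AdjoinRoot.mk_surjective x
    induction g using Polynomial.induction_on' with
    | add g1 g2 h1 h2 => simp only [map_add]; exact add_mem h1 h2
    | monomial n r =>
      rw [← C_mul_X_pow_eq_monomial, map_mul, map_pow, AdjoinRoot.mk_X, AdjoinRoot.mk_C, ← hbroot]
      simp only [map_mul, map_pow]
      refine mul_mem ?_ (pow_mem hβE _)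
      have : algebraMap K L (algebraMap A K (algebraMap R A r)) ∈ E := by
        rw [← IsScalarTower.algebraMap_apply R A K, IsScalarTower.algebraMap_apply R F K,
          ← IsScalarTower.algebraMap_apply F K L]
        exact E.algebraMap_mem _
      exact this
  have hKE : ∀ x : K, algebraMap K L x ∈ E := by
    intro x
    obtain ⟨y, z, hz, rfl⟩ := IsFractionRing.div_surjective (A := A) x
    rw [map_div₀]
    exact div_mem (hAE y) (hAE z)
  have htop : E = ⊤ := by
    rw [eq_top_iff]
    intro x _
    obtain ⟨g, rfl⟩ := AdjoinRoot.mk_surjective x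
    induction g using Polynomial.induction_on' with
    | add g1 g2 h1 h2 => simp only [map_add]; exact add_mem (h1 trivial) (h2 trivial)
    | monomial n r =>
      rw [← C_mul_X_pow_eq_monomial, map_mul, map_pow, AdjoinRoot.mk_X, AdjoinRoot.mk_C]
      exact mul_mem (hKE r) (pow_mem hγE _)
  have hdeg := (Field.primitive_element_iff_minpoly_natDegree_eq F α).1 htop
  set f := expand F e ((h.map (algebraMap R F)).scaleRoots ((algebraMap R F π) ^ k)) with hf
  have hfm : f.Monic := ((monic_scaleRoots_iff _).2 (hm.map _)).expand (by omega)
  have hfd : f.natDegree = h.natDegree * e := by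
    rw [hf, natDegree_expand, natDegree_scaleRoots, hm.natDegree_map]
  have hβroot : aeval β (h.map (algebraMap R F)) = 0 := by
    rw [aeval_map_algebraMap]
    have h1 : aeval (AdjoinRoot.root h) h = 0 := by rw [AdjoinRoot.aeval_eq, AdjoinRoot.mk_self]
    rw [← hbroot] at h1
    simp only [β]
    have hst : IsScalarTower R K L := by infer_instance
    rw [aeval_algebraMap_apply, aeval_algebraMap_apply, h1, map_zero, map_zero]
  have hfα : aeval α f = 0 := by
    rw [hf, expand_aeval, hαe]
    have := scaleRoots_aeval_eq_zero (r := (algebraMap R F π) ^ k) hβroot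
    rwa [map_zpow₀] at this
  have hαint : IsIntegral F α := IsIntegral.of_finite F α
  have heq : minpoly F α = f := by
    refine (eq_of_monic_of_dvd_of_natDegree_le (minpoly.monic hαint) hfm (minpoly.dvd F α hfα) ?_).symm
    rw [hdeg, hFL, hfd]
  rw [← heq]
  exact minpoly.irreducible hαint

theorem dvr_main {R : Type*} [CommRing R] [IsDomain R] [IsDiscreteValuationRing R]
    [Finite (IsLocalRing.ResidueField R)]
    (F : Type*) [Field F] [Algebra R F] [IsFractionRing R F]
    (n : ℕ) (hn : 1 ≤ n) (a : F) (ha : a ≠ 0) :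
    ∃ f : Polynomial F, f.Monic ∧ Irreducible f ∧ f.natDegree = n ∧ f.coeff 0 = a := by
  obtain ⟨π, hπ⟩ := IsDiscreteValuationRing.exists_irreducible R
  have hϖ0 : algebraMap R F π ≠ 0 :=
    (map_ne_zero_iff _ (IsFractionRing.injective R F)).2 hπ.ne_zero
  obtain ⟨u, m, hum⟩ : ∃ (u : Rˣ) (m : ℤ), a = algebraMap R F u * (algebraMap R F π) ^ m := by
    obtain ⟨x, y, hy, rfl⟩ := IsFractionRing.div_surjective (A := R) a
    have hx0 : x ≠ 0 := by rintro rfl; simp at ha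
    have hy0 : y ≠ 0 := nonZeroDivisors.ne_zero hy
    obtain ⟨i, u, rfl⟩ := IsDiscreteValuationRing.eq_unit_mul_pow_irreducible hx0 hπ
    obtain ⟨j, v, rfl⟩ := IsDiscreteValuationRing.eq_unit_mul_pow_irreducible hy0 hπ
    refine ⟨u * v⁻¹, i - j, ?_⟩
    have hv : algebraMap R F v * algebraMap R F ((v⁻¹ : Rˣ) : R) = 1 := by
      rw [← map_mul, Units.mul_inv, map_one]
    have hv0 : algebraMap R F v ≠ 0 := left_ne_zero_of_mul_eq_one hv
    rw [zpow_sub₀ hϖ0, zpow_natCast, zpow_natCast, Units.val_mul, map_mul, map_mul, map_mul,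
      map_pow, map_pow, eq_inv_of_mul_eq_one_right hv]
    field_simp
  have hgpos : 0 < Int.gcd n m := Int.gcd_pos_of_ne_zero_left _ (by omega)
  set d := Int.gcd n m with hd
  obtain ⟨e, he⟩ : d ∣ n := by exact_mod_cast Int.gcd_dvd_left (n : ℤ) m
  obtain ⟨k, hk⟩ : (d : ℤ) ∣ m := Int.gcd_dvd_right (n : ℤ) m
  have he1 : 1 ≤ e := by
    rcases Nat.eq_zero_or_pos e with h | h
    · rw [h] at he; omega
    · exact h
  have hbez := Int.gcd_eq_gcd_ab n m
  rw [← hd] at hbez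
  have hb : k * Int.gcdB n m + e * Int.gcdA n m = 1 := by
    have hd0 : (d : ℤ) ≠ 0 := by omega
    apply mul_left_cancel₀ hd0
    have he' : (n : ℤ) = d * e := by exact_mod_cast he
    calc (d : ℤ) * (k * Int.gcdB n m + e * Int.gcdA n m)
        = (d * e) * Int.gcdA n m + (d * k) * Int.gcdB n m := by ring
      _ = d * 1 := by rw [← he', ← hk, ← hbez, mul_one]
  obtain ⟨h, hm, hi, hdeg, h0⟩ := exists_lift R d hgpos u
  refine ⟨_, ?_, core F hm hi u h0 hπ e he1 k _ _ hb, ?_, ?_⟩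
  · exact ((monic_scaleRoots_iff _).2 (hm.map _)).expand (by omega)
  · rw [natDegree_expand, natDegree_scaleRoots, hm.natDegree_map, hdeg, he]
  · rw [← zero_mul e, coeff_expand_mul (by omega), coeff_scaleRoots, coeff_map, h0,
      hm.natDegree_map, hdeg, Nat.sub_zero, hum, hk, ← zpow_natCast, ← zpow_mul, mul_comm k]

theorem padic_dvr
    (p : ℕ) [Fact p.Prime] (F : Type*) [Field F] [Algebra ℚ_[p] F]
    [FiniteDimensional ℚ_[p] F] : ∃ (R : Subring F), ∃ (_ : IsDiscreteValuationRing R), 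
      IsFractionRing R F ∧ Finite (IsLocalRing.ResidueField R) := by
  let _ : Algebra ℤ_[p] F := ((algebraMap ℚ_[p] F).comp (algebraMap ℤ_[p] ℚ_[p])).toAlgebra
  have : IsScalarTower ℤ_[p] ℚ_[p] F := IsScalarTower.of_algebraMap_eq' rfl
  let O := integralClosure ℤ_[p] F
  have : IsDedekindDomain O := integralClosure.isDedekindDomain ℤ_[p] ℚ_[p] F
  have : IsFractionRing O F := integralClosure.isFractionRing_of_finite_extension ℚ_[p] F
  have : Module.Finite ℤ_[p] O := IsIntegralClosure.finite ℤ_[p] ℚ_[p] F O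
  obtain ⟨P, hP⟩ := Ideal.exists_maximal O
  have hc : (P.comap (algebraMap ℤ_[p] O)).IsMaximal := Ideal.isMaximal_comap_of_isIntegral_of_isMaximal P
  have hc2 := IsLocalRing.eq_maximalIdeal hc
  have hP0 : P ≠ ⊥ := by
    rintro rfl
    have hp : (p : ℤ_[p]) ∈ IsLocalRing.maximalIdeal ℤ_[p] := by
      rw [PadicInt.maximalIdeal_eq_span_p]; exact Ideal.mem_span_singleton_self _
    rw [← hc2, Ideal.mem_comap, Ideal.mem_bot, map_natCast] at hp
    have h2 := congrArg (algebraMap O F) hp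
    rw [map_natCast, map_zero, ← map_natCast (algebraMap ℚ_[p] F), map_eq_zero] at h2
    exact (Fact.out : p.Prime).ne_zero (by exact_mod_cast h2)
  have hfin : Finite (O ⧸ P) := by
    have e : Finite (ℤ_[p] ⧸ P.comap (algebraMap ℤ_[p] O)) := by
      rw [hc2]
      exact Finite.of_equiv _ (PadicInt.residueField (p := p)).symm.toEquiv
    exact Module.finite_of_finite (ℤ_[p] ⧸ P.comap (algebraMap ℤ_[p] O))
  have hS : P.primeCompl ≤ nonZeroDivisors O := Ideal.primeCompl_le_nonZeroDivisors P
  let R := Localization.subalgebra F P.primeCompl hS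
  have hl : IsLocalization.AtPrime R P := Localization.subalgebra.isLocalization_subalgebra F P.primeCompl hS
  have hd : IsDiscreteValuationRing R :=
    IsLocalization.AtPrime.isDiscreteValuationRing_of_dedekind_domain O hP0 R
  have hf : IsFractionRing R F := Localization.subalgebra.isFractionRing F P.primeCompl hS
  refine ⟨R.toSubring, hd, hf, ?_⟩
  exact Finite.of_equiv _ (IsLocalization.AtPrime.equivQuotMaximalIdeal P R).toEquiv

end


/-- For every `n ≥ 1` and `a ∈ F^×`, where `F` is a finite
extension of `ℚ_p`, there is a monic irreducible polynomial over `F` of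
degree `n` with constant term `a`. -/
theorem exists_monic_irreducible_with_constant_term
    (p : ℕ) [Fact p.Prime] (F : Type*) [Field F] [Algebra ℚ_[p] F]
    [FiniteDimensional ℚ_[p] F]
    (n : ℕ) (hn : 1 ≤ n) (a : F) (ha : a ≠ 0) :
    ∃ f : Polynomial F, f.Monic ∧ Irreducible f ∧ f.natDegree = n ∧ f.coeff 0 = a := by
  obtain ⟨R, hR, hf, hfin⟩ := padic_dvr p F
  exact dvr_main (R := R) F n hn a ha
end
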